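/- arXiv:2107.06043 — 2 statements merged into one kernel-verified Lean document; each statement's English description precedes it below -/
import Mathlib

section
/- Let Ω ⊂ ℝⁿ be a nonempty bounded open set. Suppose u ∈ W^{s,p(·,·)}(ℝⁿ) is a weak solution of (−Δ)^s_{p(·,·)}u = 0 in Ω and satisfies sup_{x∈Ω} ∫_{ℝⁿ} |u(y)|^{p(x,y)−1}(1+|y|^{n+s·p(x,y)})^{−1} dy < ∞. Then u ∈ L^∞_loc(Ω): for every x₀ ∈ Ω there exist r > 0 with B_r(x₀) ⊆ Ω and M < ∞ such that |u| ≤ M almost everywhere on B_r(x₀). -/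
open MeasureTheory Metric Set Filter
open scoped ENNReal Topology
noncomputable section

/-- `ℝⁿ` with the Euclidean norm and Lebesgue measure. -/
abbrev Rn (n : ℕ) := EuclideanSpace ℝ (Fin n)

/-- `p₊(E × F) = sup_{x ∈ E, y ∈ F} p(x,y)`. -/
def pSup {n : ℕ} (p : Rn n → Rn n → ℝ) (E F : Set (Rn n)) : ℝ :=
  sSup (Set.image2 p E F)

/-- `p₋(E × F) = inf_{x ∈ E, y ∈ F} p(x,y)`. -/
def pInf {n : ℕ} (p : Rn n → Rn n → ℝ) (E F : Set (Rn n)) : ℝ :=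
  sInf (Set.image2 p E F)

/-- Standing assumptions on the variable exponent: continuity, symmetry and
`1 < inf p ≤ sup p < ∞`. -/
def ExponentOK {n : ℕ} (p : Rn n → Rn n → ℝ) : Prop :=
  Continuous (fun z : Rn n × Rn n => p z.1 z.2) ∧ (∀ x y, p x y = p y x) ∧
    ∃ pm pM : ℝ, 1 < pm ∧ ∀ x y, pm ≤ p x y ∧ p x y ≤ pM

/-- Membership in the fractional Sobolev space `W^{s,p(·,·)}(ℝⁿ)`. -/
def MemW {n : ℕ} (s : ℝ) (p : Rn n → Rn n → ℝ) (u : Rn n → ℝ) : Prop :=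
  Measurable u ∧
    (∫⁻ x, ENNReal.ofReal (|u x| ^ p x x)) < ⊤ ∧
    (∫⁻ x, ∫⁻ y, ENNReal.ofReal (|u x - u y| ^ p x y / ‖x - y‖ ^ ((n : ℝ) + s * p x y))) < ⊤

/-- Weak subsolution of `(-Δ)^s_{p(·,·)} u = 0` in `Ω`. -/
def IsWeakSubsol {n : ℕ} (s : ℝ) (p : Rn n → Rn n → ℝ) (Ω : Set (Rn n)) (u : Rn n → ℝ) : Prop :=
  ∀ φ : Rn n → ℝ, MemW s p φ → (∀ x, 0 ≤ φ x) → (∀ᵐ x, x ∉ Ω → φ x = 0) →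
    (∫ x, ∫ y, |u x - u y| ^ (p x y - 2) * (u x - u y) * (φ x - φ y)
      / ‖x - y‖ ^ ((n : ℝ) + s * p x y)) ≤ 0

/-- Weak supersolution of `(-Δ)^s_{p(·,·)} u = 0` in `Ω`. -/
def IsWeakSupersol {n : ℕ} (s : ℝ) (p : Rn n → Rn n → ℝ) (Ω : Set (Rn n)) (u : Rn n → ℝ) : Prop :=
  ∀ φ : Rn n → ℝ, MemW s p φ → (∀ x, 0 ≤ φ x) → (∀ᵐ x, x ∉ Ω → φ x = 0) →
    0 ≤ (∫ x, ∫ y, |u x - u y| ^ (p x y - 2) * (u x - u y) * (φ x - φ y)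
      / ‖x - y‖ ^ ((n : ℝ) + s * p x y))

/-- Weak solution of `(-Δ)^s_{p(·,·)} u = 0` in `Ω`. -/
def IsWeakSol {n : ℕ} (s : ℝ) (p : Rn n → Rn n → ℝ) (Ω : Set (Rn n)) (u : Rn n → ℝ) : Prop :=
  IsWeakSubsol s p Ω u ∧ IsWeakSupersol s p Ω u

/-- Condition (P1) in `Ω` with constant `L`. -/
def CondP1 {n : ℕ} (p : Rn n → Rn n → ℝ) (Ω : Set (Rn n)) (L : ℝ) : Prop :=
  ∀ (x₀ : Rn n) (R : ℝ), 0 < R → closedBall x₀ R ⊆ Ω →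
    R ^ (pInf p (ball x₀ R) (ball x₀ R) - pSup p (ball x₀ R) (ball x₀ R)) ≤ L

/-- Condition (P2) in `Ω`. -/
def CondP2 {n : ℕ} (p : Rn n → Rn n → ℝ) (Ω : Set (Rn n)) : Prop :=
  ∀ (x₀ : Rn n) (R : ℝ), 0 < R → closedBall x₀ R ⊆ Ω →
    pSup p (ball x₀ R) ((ball x₀ R)ᶜ) ≤ pSup p (ball x₀ R) (ball x₀ R) ∧
    pInf p (ball x₀ R) ((ball x₀ R)ᶜ) ≤ pInf p (ball x₀ R) (ball x₀ R)

/-- The bounded increasing truncation `1 - (1 + (t - k)₊)^(-β)` used in test functions. -/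
def trunc (β k t : ℝ) : ℝ := 1 - (max (t - k) 0 + 1) ^ (-β)

lemma rpow_neg_sub_ge {β X Y : ℝ} (hβ : 0 < β) (hβ1 : β ≤ 1) (hY : 1 ≤ Y) (hYX : Y ≤ X) :
    β * X ^ (-β - 1) * (X - Y) ≤ Y ^ (-β) - X ^ (-β) := by
  have hX : 0 < X := by linarith
  have hY0 : 0 < Y := by linarith
  set r := Y / X with hr
  have hr0 : 0 < r := by positivity
  have hYr : Y = r * X := by rw [hr]; field_simp
  have h1 : r ^ β ≤ 1 + β * (r - 1) := by
    have := rpow_one_add_le_one_add_mul_self (s := r - 1) (p := β) (by linarith) hβ.le hβ1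
    simpa using this
  have ht : 0 < r ^ β := Real.rpow_pos_of_pos hr0 _
  have h2 : 2 - r ^ β ≤ (r ^ β)⁻¹ := by
    rw [← sub_nonneg]
    have : (r ^ β)⁻¹ - (2 - r ^ β) = (r ^ β - 1) ^ 2 / r ^ β := by field_simp; ring
    rw [this]; positivity
  have hXb : 0 < X ^ (-β) := Real.rpow_pos_of_pos hX _
  have h3 : Y ^ (-β) = (r ^ β)⁻¹ * X ^ (-β) := by
    rw [hYr, Real.mul_rpow hr0.le hX.le, Real.rpow_neg hr0.le]
  have h4 : β * X ^ (-β - 1) * (X - Y) = X ^ (-β) * (β * (1 - r)) := by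
    rw [Real.rpow_sub hX, Real.rpow_one, hYr]; field_simp
  rw [h3, h4]
  nlinarith

lemma rpow_neg_sub_le {β X Y : ℝ} (hβ : 0 < β) (hβ1 : β ≤ 1) (hY : 1 ≤ Y) (hYX : Y ≤ X) :
    Y ^ (-β) - X ^ (-β) ≤ X - Y := by
  have hX : 0 < X := by linarith
  have hY0 : 0 < Y := by linarith
  set r := Y / X with hr
  have hr0 : 0 < r := by positivity
  have hr1 : r ≤ 1 := by rw [hr, div_le_one hX]; exact hYX
  have h1 : r ≤ r ^ β := by
    simpa using Real.rpow_le_rpow_of_exponent_ge hr0 hr1 hβ1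
  have h2 : X ^ (-β) = r ^ β * Y ^ (-β) := by
    rw [hr, Real.div_rpow hY0.le hX.le, Real.rpow_neg hX.le, Real.rpow_neg hY0.le]
    have := Real.rpow_pos_of_pos hX β
    have := Real.rpow_pos_of_pos hY0 β
    field_simp
  have h3 : Y ^ (-β) ≤ 1 := Real.rpow_le_one_of_one_le_of_nonpos hY (by linarith)
  have h4 : 0 < Y ^ (-β) := Real.rpow_pos_of_pos hY0 _
  have h5 : X - Y = X * (1 - r) := by rw [hr]; field_simp
  rw [h2, h5]
  nlinarith

section Trunc

variable {β k : ℝ}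

lemma trunc_nonneg (hβ : 0 < β) (t : ℝ) : 0 ≤ trunc β k t := by
  have := Real.rpow_le_one_of_one_le_of_nonpos (x := max (t - k) 0 + 1) (z := -β)
    (by linarith [le_max_right (t - k) 0]) (by linarith)
  unfold trunc; linarith

lemma trunc_le_one (t : ℝ) : trunc β k t ≤ 1 := by
  have : 0 ≤ (max (t - k) 0 + 1) ^ (-β) :=
    Real.rpow_nonneg (by linarith [le_max_right (t - k) 0]) _
  unfold trunc; linarith

lemma trunc_of_le {t : ℝ} (h : t ≤ k) : trunc β k t = 0 := by
  simp [trunc, max_eq_right (sub_nonpos.2 h)]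

lemma lt_of_trunc_ne_zero {t : ℝ} (h : trunc β k t ≠ 0) : k < t := by
  by_contra! h'
  exact h (trunc_of_le h')

lemma trunc_sub_ge (hβ : 0 < β) (hβ1 : β ≤ 1) {a b : ℝ} (h : b ≤ a) :
    β * (max (a - k) 0 + 1) ^ (-β - 1) * (max (a - k) 0 - max (b - k) 0)
      ≤ trunc β k a - trunc β k b := by
  have hm : max (b - k) 0 ≤ max (a - k) 0 := max_le_max (by linarith) le_rfl
  have := rpow_neg_sub_ge (X := max (a - k) 0 + 1) (Y := max (b - k) 0 + 1) hβ hβ1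
    (by linarith [le_max_right (b - k) 0]) (by linarith)
  unfold trunc
  rw [show max (a - k) 0 + 1 - (max (b - k) 0 + 1) = max (a - k) 0 - max (b - k) 0 by ring] at this
  linarith

lemma trunc_mono (hβ : 0 < β) (hβ1 : β ≤ 1) {a b : ℝ} (h : b ≤ a) :
    trunc β k b ≤ trunc β k a := by
  have hm : max (b - k) 0 ≤ max (a - k) 0 := max_le_max (by linarith) le_rfl
  have h1 : 0 ≤ (max (a - k) 0 + 1) ^ (-β - 1) :=
    Real.rpow_nonneg (by linarith [le_max_right (a - k) 0]) _
  have := trunc_sub_ge (k := k) hβ hβ1 h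
  have h2 : 0 ≤ β * (max (a - k) 0 + 1) ^ (-β - 1) * (max (a - k) 0 - max (b - k) 0) :=
    mul_nonneg (mul_nonneg hβ.le h1) (by linarith)
  linarith

lemma abs_trunc_sub_le (hβ : 0 < β) (hβ1 : β ≤ 1) (a b : ℝ) :
    |trunc β k a - trunc β k b| ≤ |a - b| := by
  wlog h : b ≤ a generalizing a b
  · rw [abs_sub_comm, abs_sub_comm a b]
    exact this b a (not_le.1 h).le
  rw [abs_of_nonneg (sub_nonneg.2 (trunc_mono hβ hβ1 h)), abs_of_nonneg (sub_nonneg.2 h)]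
  have hm : max (b - k) 0 ≤ max (a - k) 0 := max_le_max (by linarith) le_rfl
  have h1 := rpow_neg_sub_le (X := max (a - k) 0 + 1) (Y := max (b - k) 0 + 1) hβ hβ1
    (by linarith [le_max_right (b - k) 0]) (by linarith)
  have h2 : max (a - k) 0 - max (b - k) 0 ≤ a - b := by
    rcases max_cases (a - k) 0 with h3 | h3 <;> rcases max_cases (b - k) 0 with h4 | h4 <;> linarith
  unfold trunc
  linarith

lemma measurable_trunc : Measurable (trunc β k) := by
  unfold trunc; fun_prop

lemma pow_sub_pow_le_mul {a b : ℝ} (q : ℕ) (ha : 0 ≤ a) (hab : a ≤ b) :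
    b ^ q - a ^ q ≤ q * b ^ (q - 1) * (b - a) := by
  have h := abs_pow_sub_pow_le b a q
  rw [abs_of_nonneg (sub_nonneg.2 hab), abs_of_nonneg ha, abs_of_nonneg (ha.trans hab),
    max_eq_left hab] at h
  linarith [le_abs_self (b ^ q - a ^ q)]

/-- Lower bound for the near-diagonal interaction, tested with a truncation times a cutoff. -/
lemma near_lower {a b p hx hy : ℝ} {q : ℕ} (hβ : 0 < β) (hβ1 : β ≤ 1) (hp : 1 < p)
    (hpq : p ≤ q) (hx0 : 0 ≤ hx) (hy0 : 0 ≤ hy) (hy1 : hy ≤ 1)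
    (hba : b ≤ a)
    (hneg : trunc β k a * hx ^ q < trunc β k b * hy ^ q) :
    (a - b) ^ (p - 1) * (trunc β k b * hy ^ q - trunc β k a * hx ^ q)
      ≤ (q * |hx - hy| / β) ^ p * (max (a - k) 0 + 1) ^ ((1 + β) * (p - 1)) := by
  have hq1 : (1 : ℝ) < q := by linarith
  have hq : 1 ≤ q := by exact_mod_cast hq1.le
  have hGb0 : 0 ≤ trunc β k b := trunc_nonneg hβ b
  have hGa1 : trunc β k a ≤ 1 := trunc_le_one a
  have hGab : trunc β k b ≤ trunc β k a := trunc_mono hβ hβ1 hba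
  have hhx : 0 ≤ hx ^ q := by positivity
  have hhy : 0 ≤ hy ^ q := by positivity
  have hGb : 0 < trunc β k b := by
    refine lt_of_le_of_ne hGb0 fun h => ?_
    rw [← h] at hneg; nlinarith
  have hbk : k < b := lt_of_trunc_ne_zero hGb.ne'
  have hxy : hx < hy := by
    by_contra! h
    have := pow_le_pow_left₀ hy0 h q
    nlinarith
  have hy_pos : 0 < hy := lt_of_le_of_lt hx0 hxy
  have hδ : |hx - hy| = hy - hx := by rw [abs_of_neg (by linarith)]; ring
  rw [hδ]
  set δ := hy - hx with hδd
  have hδ0 : 0 < δ := by rw [hδd]; linarith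
  have hma : max (a - k) 0 = a - k := max_eq_left (by linarith)
  have hmb : max (b - k) 0 = b - k := max_eq_left (by linarith)
  have hpow : hy ^ q - hx ^ q ≤ q * hy ^ (q - 1) * δ := pow_sub_pow_le_mul q hx0 hxy.le
  have hyq : hy ^ q = hy ^ (q - 1) * hy := by
    rw [← pow_succ, Nat.sub_add_cancel hq]
  have hyq1 : 0 < hy ^ (q - 1) := by positivity
  have hdiff := trunc_sub_ge (k := k) hβ hβ1 hba
  rw [hma, hmb] at hdiff
  rw [hma]
  set X := a - k + 1 with hX
  have hXpos : 0 < X := by rw [hX]; linarith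
  have hmul : (trunc β k a - trunc β k b) * hy ≤ q * δ := by
    have : (trunc β k a - trunc β k b) * hy * hy ^ (q - 1) ≤ q * δ * hy ^ (q - 1) := by
      nlinarith [pow_le_pow_left₀ hx0 hxy.le q]
    exact le_of_mul_le_mul_right this hyq1
  have hD : (a - b) * hy ≤ q * δ / β * X ^ (1 + β) := by
    have e1 : X ^ (-β - 1) = (X ^ (1 + β))⁻¹ := by
      rw [← Real.rpow_neg hXpos.le]; congr 1; ring
    have hXb : 0 < X ^ (1 + β) := Real.rpow_pos_of_pos hXpos _
    rw [e1] at hdiff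
    have : β * (X ^ (1 + β))⁻¹ * (a - b) * hy ≤ q * δ := by
      refine le_trans ?_ hmul
      refine mul_le_mul_of_nonneg_right ?_ hy0
      refine le_trans (le_of_eq ?_) hdiff
      ring
    have h2 : (a - b) * hy = (β * (X ^ (1 + β))⁻¹ * (a - b) * hy) * (X ^ (1 + β) / β) := by
      field_simp
    rw [h2]
    calc _ ≤ (q * δ) * (X ^ (1 + β) / β) := mul_le_mul_of_nonneg_right this (by positivity)
      _ = _ := by ring
  have hab0 : 0 ≤ a - b := by linarith
  have hyp : hy ^ (q - 1) ≤ hy ^ (p - 1) := by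
    rw [← Real.rpow_natCast hy (q - 1)]
    apply Real.rpow_le_rpow_of_exponent_ge hy_pos hy1
    rw [Nat.cast_sub hq]; push_cast; linarith
  have hrp : 0 ≤ (a - b) ^ (p - 1) := Real.rpow_nonneg hab0 _
  calc (a - b) ^ (p - 1) * (trunc β k b * hy ^ q - trunc β k a * hx ^ q)
      ≤ (a - b) ^ (p - 1) * (hy ^ (p - 1) * (q * δ)) := by
        refine mul_le_mul_of_nonneg_left ?_ hrp
        have e1 : trunc β k b * hy ^ q - trunc β k a * hx ^ q ≤ hy ^ q - hx ^ q := by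
          nlinarith [pow_le_pow_left₀ hx0 hxy.le q]
        have e2 : (q : ℝ) * hy ^ (q - 1) * δ ≤ hy ^ (p - 1) * (q * δ) := by
          have : 0 ≤ (q : ℝ) * δ := by positivity
          nlinarith
        linarith
    _ = ((a - b) * hy) ^ (p - 1) * (q * δ) := by
        rw [Real.mul_rpow hab0 hy0]; ring
    _ ≤ (q * δ / β * X ^ (1 + β)) ^ (p - 1) * (q * δ / β) := by
        refine mul_le_mul (Real.rpow_le_rpow (by positivity) hD (by linarith)) ?_ (by positivity)
          (Real.rpow_nonneg (by positivity) _)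
        rw [le_div_iff₀ hβ]
        have : 0 ≤ (q : ℝ) * δ := by positivity
        nlinarith
    _ = _ := by
        have h0 : 0 < q * δ / β := by positivity
        rw [Real.mul_rpow h0.le (by positivity), ← Real.rpow_mul hXpos.le,
          Real.rpow_sub h0, Real.rpow_one]
        field_simp

end Trunc

/-- A radial integrable kernel on `ℝⁿ`, comparable to `|z|^(1-s-n)` near the origin and to
`|z|^(-s-n)` at infinity. -/
def kern (n : ℕ) (s : ℝ) (z : Rn n) : ℝ :=
  if ‖z‖ < 1 then ‖z‖ ^ (1 - s - n) else ‖z‖ ^ (-s - n)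

section Kernel

variable {n : ℕ} {s : ℝ}

lemma kern_nonneg (z : Rn n) : 0 ≤ kern n s z := by
  unfold kern; split_ifs <;> positivity

lemma kern_neg (z : Rn n) : kern n s (-z) = kern n s z := by
  simp [kern]

lemma measurable_kern : Measurable (kern n s) := by
  unfold kern
  refine Measurable.ite (measurableSet_lt measurable_norm measurable_const) ?_ ?_ <;> fun_prop

lemma integrable_kern (hn : 1 ≤ n) (hs : s ∈ Set.Ioo (0 : ℝ) 1) :
    Integrable (kern n s) volume := by
  obtain ⟨hs0, hs1⟩ := hs
  have : Nonempty (Fin n) := ⟨⟨0, hn⟩⟩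
  have := (integrable_fun_norm_addHaar (E := Rn n) volume
    (f := fun y : ℝ => if y < 1 then y ^ (1 - s - n) else y ^ (-s - n))).2 ?_
  · exact this
  rw [← Ioc_union_Ioi_eq_Ioi (zero_le_one' ℝ), finrank_euclideanSpace_fin]
  have key : ∀ y : ℝ, 0 < y → ∀ e : ℝ, y ^ (n - 1) * y ^ (e - n) = y ^ (e - 1) := by
    intro y hy e
    rw [← Real.rpow_natCast y (n - 1), ← Real.rpow_add hy, Nat.cast_sub hn]
    congr 1; push_cast; ring
  refine IntegrableOn.union ?_ ?_
  · rw [integrableOn_Ioc_iff_integrableOn_Ioo]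
    have h1 : IntegrableOn (fun y : ℝ => y ^ (-s)) (Ioo 0 1) := by
      rw [← integrableOn_Ioc_iff_integrableOn_Ioo, ← intervalIntegrable_iff_integrableOn_Ioc_of_le
        zero_le_one]
      exact intervalIntegral.intervalIntegrable_rpow' (by linarith)
    refine h1.congr_fun (fun y hy => ?_) measurableSet_Ioo
    simp only [smul_eq_mul, if_pos hy.2]
    rw [key y hy.1]; congr 1; ring
  · have h1 : IntegrableOn (fun y : ℝ => y ^ (-s - 1)) (Ioi 1) :=
      integrableOn_Ioi_rpow_of_lt (by linarith) one_pos
    refine h1.congr_fun (fun y hy => ?_) measurableSet_Ioi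
    have hy' : ¬ y < 1 := not_lt.2 (le_of_lt hy)
    simp only [smul_eq_mul, if_neg hy']
    rw [key y (by linarith [mem_Ioi.1 hy])]

lemma lintegral_kern_lt_top (hn : 1 ≤ n) (hs : s ∈ Set.Ioo (0 : ℝ) 1) :
    ∫⁻ z, ENNReal.ofReal (kern n s z) < ⊤ :=
  (integrable_kern hn hs).lintegral_lt_top

lemma lintegral_kern_sub (x : Rn n) :
    ∫⁻ y, ENNReal.ofReal (kern n s (x - y)) = ∫⁻ z, ENNReal.ofReal (kern n s z) :=
  lintegral_sub_left_eq_self (fun z => ENNReal.ofReal (kern n s z)) x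

/-- Near the diagonal the Lipschitz part of a difference quotient is controlled by `kern`. -/
lemma norm_rpow_div_le_kern {z : Rn n} {e : ℝ} (hs : s < 1) (he : 1 ≤ e) (hz : ‖z‖ < 1) :
    ‖z‖ ^ e / ‖z‖ ^ ((n : ℝ) + s * e) ≤ kern n s z := by
  rw [kern, if_pos hz]
  rcases eq_or_lt_of_le (norm_nonneg z) with h0 | h0
  · rw [← h0, Real.zero_rpow (by linarith), zero_div]
    positivity
  · rw [← Real.rpow_sub h0]
    apply Real.rpow_le_rpow_of_exponent_ge h0 hz.le
    nlinarith

lemma one_div_norm_rpow_le_kern {z : Rn n} {e : ℝ} (hs : 0 < s) (he : 1 ≤ e) (hz : 1 ≤ ‖z‖) :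
    1 / ‖z‖ ^ ((n : ℝ) + s * e) ≤ kern n s z := by
  rw [kern, if_neg (not_lt.2 hz), one_div, ← Real.rpow_neg (norm_nonneg z)]
  apply Real.rpow_le_rpow_of_exponent_le hz
  nlinarith

end Kernel

/-- A Lipschitz cutoff, equal to one on the ball of radius `ρ + d / 3` and to zero outside the
ball of radius `ρ + 2 * d / 3`. -/
def cutoff {n : ℕ} (x₀ : Rn n) (ρ d : ℝ) (x : Rn n) : ℝ :=
  max 0 (min 1 ((ρ + 2 * d / 3 - dist x x₀) * (3 / d)))

section Cutoff

variable {n : ℕ} {x₀ : Rn n} {ρ d : ℝ}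

lemma cutoff_nonneg (x : Rn n) : 0 ≤ cutoff x₀ ρ d x := le_max_left _ _

lemma cutoff_le_one (x : Rn n) : cutoff x₀ ρ d x ≤ 1 :=
  max_le zero_le_one (min_le_left _ _)

lemma cutoff_eq_one (hd : 0 < d) {x : Rn n} (hx : dist x x₀ ≤ ρ + d / 3) :
    cutoff x₀ ρ d x = 1 := by
  have : 1 ≤ (ρ + 2 * d / 3 - dist x x₀) * (3 / d) := by
    rw [mul_div_assoc', le_div_iff₀ hd]; linarith
  rw [cutoff, min_eq_left this, max_eq_right zero_le_one]

lemma dist_lt_of_cutoff_ne_zero (hd : 0 < d) {x : Rn n} (hx : cutoff x₀ ρ d x ≠ 0) :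
    dist x x₀ < ρ + 2 * d / 3 := by
  by_contra! h
  apply hx
  rw [cutoff, max_eq_left]
  refine (min_le_right _ _).trans (mul_nonpos_of_nonpos_of_nonneg (by linarith) (by positivity))

lemma abs_cutoff_sub_le (hd : 0 < d) (x y : Rn n) :
    |cutoff x₀ ρ d x - cutoff x₀ ρ d y| ≤ 3 / d * ‖x - y‖ := by
  unfold cutoff
  have h1 := abs_max_sub_max_le_max 0 (min 1 ((ρ + 2 * d / 3 - dist x x₀) * (3 / d)))
    0 (min 1 ((ρ + 2 * d / 3 - dist y x₀) * (3 / d)))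
  have h2 := abs_min_sub_min_le_max 1 ((ρ + 2 * d / 3 - dist x x₀) * (3 / d))
    1 ((ρ + 2 * d / 3 - dist y x₀) * (3 / d))
  rw [sub_self, abs_zero] at h1 h2
  refine (h1.trans_eq (max_eq_right (abs_nonneg _))).trans
    ((h2.trans_eq (max_eq_right (abs_nonneg _))).trans ?_)
  have h3 : |dist y x₀ - dist x x₀| ≤ ‖x - y‖ := by
    rw [← dist_eq_norm, dist_comm x y]; exact abs_dist_sub_le y x x₀
  rw [← sub_mul, abs_mul, abs_of_pos (by positivity : 0 < 3 / d), mul_comm]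
  refine mul_le_mul_of_nonneg_left (le_trans (le_of_eq ?_) h3) (by positivity)
  congr 1; ring

lemma measurable_cutoff : Measurable (cutoff x₀ ρ d) := by
  unfold cutoff; fun_prop

end Cutoff

/-- The integrand of the weak formulation. -/
def formIntegrand {n : ℕ} (s : ℝ) (p : Rn n → Rn n → ℝ) (u φ : Rn n → ℝ) (x y : Rn n) : ℝ :=
  |u x - u y| ^ (p x y - 2) * (u x - u y) * (φ x - φ y) / ‖x - y‖ ^ ((n : ℝ) + s * p x y)

lemma abs_rpow_sub_two_mul {t p : ℝ} (hp : 1 < p) (ht : 0 ≤ t) :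
    |t| ^ (p - 2) * t = t ^ (p - 1) := by
  rcases eq_or_lt_of_le ht with h | h
  · rw [← h, mul_zero, Real.zero_rpow (by linarith)]
  · rw [abs_of_pos h, ← Real.rpow_add_one h.ne']; congr 1; ring

lemma rpow_sub_one_mul_le {t r p : ℝ} (hp : 1 < p) (ht : 0 ≤ t) (hr : 0 ≤ r) :
    t ^ (p - 1) * r ≤ t ^ p + r ^ p := by
  have aux : ∀ w : ℝ, 0 ≤ w → w ^ (p - 1) * w = w ^ p := by
    intro w hw
    rcases eq_or_lt_of_le hw with h | h
    · rw [← h, mul_zero, Real.zero_rpow (by linarith)]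
    · rw [← Real.rpow_add_one h.ne']; congr 1; ring
  have h1 : 0 ≤ t ^ p := Real.rpow_nonneg ht _
  have h2 : 0 ≤ r ^ p := Real.rpow_nonneg hr _
  rcases le_total r t with h | h
  · have := mul_le_mul_of_nonneg_left h (Real.rpow_nonneg ht (p - 1))
    rw [aux t ht] at this; linarith
  · have := mul_le_mul_of_nonneg_right (Real.rpow_le_rpow ht h (by linarith : 0 ≤ p - 1)) hr
    rw [aux r hr] at this; linarith

section Form

variable {n : ℕ} {s : ℝ} {p : Rn n → Rn n → ℝ} {u φ : Rn n → ℝ}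

lemma formIntegrand_symm (hsymm : ∀ x y, p x y = p y x) (x y : Rn n) :
    formIntegrand s p u φ x y = formIntegrand s p u φ y x := by
  unfold formIntegrand
  rw [hsymm y x, abs_sub_comm (u y), norm_sub_rev y x]
  ring

lemma measurable_formIntegrand (hpc : Measurable fun z : Rn n × Rn n => p z.1 z.2)
    (hu : Measurable u) (hφ : Measurable φ) :
    Measurable fun z : Rn n × Rn n => formIntegrand s p u φ z.1 z.2 := by
  unfold formIntegrand
  fun_prop

lemma measurable_seminorm_integrand (hpc : Measurable fun z : Rn n × Rn n => p z.1 z.2)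
    (hu : Measurable u) :
    Measurable fun z : Rn n × Rn n =>
      |u z.1 - u z.2| ^ p z.1 z.2 / ‖z.1 - z.2‖ ^ ((n : ℝ) + s * p z.1 z.2) := by
  fun_prop

lemma abs_formIntegrand_le (hp : ∀ x y, 1 < p x y) (x y : Rn n) :
    |formIntegrand s p u φ x y| ≤
      |u x - u y| ^ p x y / ‖x - y‖ ^ ((n : ℝ) + s * p x y)
        + |φ x - φ y| ^ p x y / ‖x - y‖ ^ ((n : ℝ) + s * p x y) := by
  have hN : 0 ≤ ‖x - y‖ ^ ((n : ℝ) + s * p x y) := by positivity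
  have h1 : |(|u x - u y| ^ (p x y - 2) * (u x - u y))| = |u x - u y| ^ (p x y - 1) := by
    rw [abs_mul, abs_of_nonneg (Real.rpow_nonneg (abs_nonneg _) _)]
    have := abs_rpow_sub_two_mul (hp x y) (abs_nonneg (u x - u y))
    rwa [abs_abs] at this
  rw [formIntegrand, abs_div, abs_mul, h1, abs_of_nonneg hN, ← add_div]
  exact div_le_div_of_nonneg_right
    (rpow_sub_one_mul_le (hp x y) (abs_nonneg _) (abs_nonneg _)) hN

lemma integrable_formIntegrand (hpc : Measurable fun z : Rn n × Rn n => p z.1 z.2)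
    (hp : ∀ x y, 1 < p x y) (hu : MemW s p u) (hφ : MemW s p φ) :
    Integrable (fun z : Rn n × Rn n => formIntegrand s p u φ z.1 z.2) (volume.prod volume) := by
  have aux : ∀ {v : Rn n → ℝ}, MemW s p v → Integrable (fun z : Rn n × Rn n =>
      |v z.1 - v z.2| ^ p z.1 z.2 / ‖z.1 - z.2‖ ^ ((n : ℝ) + s * p z.1 z.2))
      (volume.prod volume) := by
    intro v hv
    have hm := measurable_seminorm_integrand (s := s) hpc hv.1
    refine ⟨hm.aestronglyMeasurable, ?_⟩
    rw [hasFiniteIntegral_iff_ofReal (Eventually.of_forall fun z => by positivity),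
      lintegral_prod _ hm.ennreal_ofReal.aemeasurable]
    exact hv.2.2
  refine ((aux hu).add (aux hφ)).mono'
    (measurable_formIntegrand hpc hu.1 hφ.1).aestronglyMeasurable
    (Eventually.of_forall fun z => ?_)
  exact abs_formIntegrand_le hp z.1 z.2

/-- If the form is nonpositive and becomes nonnegative pointwise after adding a symmetrized error,
then the integral of the sum is controlled by the error. -/
lemma lintegral_form_add_error_le (hpc : Measurable fun z : Rn n × Rn n => p z.1 z.2)
    (hp : ∀ x y, 1 < p x y) (hu : MemW s p u) (hφ : MemW s p φ)
    (hle : ∫ x, ∫ y, formIntegrand s p u φ x y ≤ 0)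
    {e : Rn n → Rn n → ℝ} (hem : Measurable fun z : Rn n × Rn n => e z.1 z.2)
    (he0 : ∀ x y, 0 ≤ e x y)
    (hpos : ∀ x y, 0 ≤ formIntegrand s p u φ x y + e x y + e y x) :
    ∫⁻ x, ∫⁻ y, ENNReal.ofReal (formIntegrand s p u φ x y + e x y + e y x) ≤
      2 * ∫⁻ x, ∫⁻ y, ENNReal.ofReal (e x y) := by
  rcases eq_or_ne (∫⁻ x, ∫⁻ y, ENNReal.ofReal (e x y)) ⊤ with htop | htop
  · simp [htop]
  have hF := integrable_formIntegrand hpc hp hu hφ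
  have hEl : ∫⁻ z : Rn n × Rn n, ENNReal.ofReal (e z.1 z.2) ∂(volume.prod volume) =
      ∫⁻ x, ∫⁻ y, ENNReal.ofReal (e x y) := lintegral_prod _ hem.ennreal_ofReal.aemeasurable
  have hE : Integrable (fun z : Rn n × Rn n => e z.1 z.2) (volume.prod volume) := by
    refine ⟨hem.aestronglyMeasurable, ?_⟩
    rw [hasFiniteIntegral_iff_ofReal (Eventually.of_forall fun z => he0 _ _), hEl]
    exact htop.lt_top
  have hE' : Integrable (fun z : Rn n × Rn n => e z.2 z.1) (volume.prod volume) := hE.swap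
  have hFE : Integrable (fun z : Rn n × Rn n => formIntegrand s p u φ z.1 z.2 + e z.1 z.2)
      (volume.prod volume) := hF.add hE
  have hFEE : Integrable (fun z : Rn n × Rn n => formIntegrand s p u φ z.1 z.2 + e z.1 z.2
      + e z.2 z.1) (volume.prod volume) := hFE.add hE'
  have hsum : Measurable fun z : Rn n × Rn n =>
      formIntegrand s p u φ z.1 z.2 + e z.1 z.2 + e z.2 z.1 :=
    ((measurable_formIntegrand hpc hu.1 hφ.1).add hem).add (hem.comp measurable_swap)
  have hEint : ∫ z : Rn n × Rn n, e z.2 z.1 ∂(volume.prod volume) =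
      ∫ z : Rn n × Rn n, e z.1 z.2 ∂(volume.prod volume) :=
    integral_prod_swap (μ := volume) (ν := volume) (fun z : Rn n × Rn n => e z.1 z.2)
  have h2 : ∫⁻ x, ∫⁻ y, ENNReal.ofReal (e x y) =
      ENNReal.ofReal (∫ z : Rn n × Rn n, e z.1 z.2 ∂(volume.prod volume)) := by
    rw [← hEl, ofReal_integral_eq_lintegral_ofReal hE (Eventually.of_forall fun z => he0 _ _)]
  have h1 : ∫⁻ x, ∫⁻ y, ENNReal.ofReal (formIntegrand s p u φ x y + e x y + e y x) =
      ENNReal.ofReal (∫ z : Rn n × Rn n, (formIntegrand s p u φ z.1 z.2 + e z.1 z.2 + e z.2 z.1)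
        ∂(volume.prod volume)) := by
    rw [ofReal_integral_eq_lintegral_ofReal hFEE
      (Eventually.of_forall fun z => hpos _ _)]
    exact (lintegral_prod _ hsum.ennreal_ofReal.aemeasurable).symm
  have h3 : ∫ z : Rn n × Rn n, formIntegrand s p u φ z.1 z.2 ∂(volume.prod volume) ≤ 0 := by
    rw [integral_prod _ hF]; exact hle
  have h4 : ∫ z : Rn n × Rn n, (formIntegrand s p u φ z.1 z.2 + e z.1 z.2 + e z.2 z.1)
        ∂(volume.prod volume) ≤ 2 * ∫ z : Rn n × Rn n, e z.1 z.2 ∂(volume.prod volume) := by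
    rw [integral_add hFE hE', integral_add hF hE, hEint]
    linarith
  rw [h1, h2]
  refine (ENNReal.ofReal_le_ofReal h4).trans (le_of_eq ?_)
  rw [ENNReal.ofReal_mul zero_le_two]
  simp

end Form

lemma lintegral_indicator_kern_lt_top {n : ℕ} {s : ℝ} (hn : 1 ≤ n) (hs : s ∈ Set.Ioo (0 : ℝ) 1)
    {B : Set (Rn n)} (hB : MeasurableSet B) (hBf : volume B < ⊤) :
    ∫⁻ x, ∫⁻ y, B.indicator 1 x * ENNReal.ofReal (kern n s (x - y)) < ⊤ := by
  have h : ∀ x, ∫⁻ y, B.indicator 1 x * ENNReal.ofReal (kern n s (x - y)) =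
      B.indicator 1 x * ∫⁻ z, ENNReal.ofReal (kern n s z) := by
    intro x
    rw [lintegral_const_mul _ (by have := measurable_kern (n := n) (s := s); fun_prop),
      lintegral_kern_sub]
  simp_rw [h]
  rw [lintegral_mul_const _ (measurable_one.indicator hB), lintegral_indicator_one hB]
  exact ENNReal.mul_lt_top hBf (lintegral_kern_lt_top hn hs)

lemma lintegral_lintegral_const_mul_add_add {X : Type*} [MeasurableSpace X] {μ : Measure X}
    [SFinite μ] {c : ℝ≥0∞} (hc : c ≠ ⊤) {f g : X → X → ℝ≥0∞} {h : X → X → ℝ≥0∞}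
    (hf : Measurable fun z : X × X => f z.1 z.2) (hg : Measurable fun z : X × X => g z.1 z.2) :
    ∫⁻ x, ∫⁻ y, c * (f x y + (g x y + h x y)) ∂μ ∂μ = c * (∫⁻ x, ∫⁻ y, f x y ∂μ ∂μ +
      (∫⁻ x, ∫⁻ y, g x y ∂μ ∂μ + ∫⁻ x, ∫⁻ y, h x y ∂μ ∂μ)) := by
  have e1 : ∀ x, ∫⁻ y, c * (f x y + (g x y + h x y)) ∂μ =
      c * (∫⁻ y, f x y ∂μ + (∫⁻ y, g x y ∂μ + ∫⁻ y, h x y ∂μ)) := by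
    intro x
    have hfx : Measurable (f x) := hf.comp measurable_prodMk_left
    have hgx : Measurable (g x) := hg.comp measurable_prodMk_left
    rw [lintegral_const_mul' _ _ hc, lintegral_add_left hfx, lintegral_add_left hgx]
  simp_rw [e1]
  rw [lintegral_const_mul' _ _ hc, lintegral_add_left (Measurable.lintegral_prod_right hf),
    lintegral_add_left (Measurable.lintegral_prod_right hg)]

/-- A bounded, compactly supported function whose increments are controlled by those of a function
in the Sobolev space and by a Lipschitz function belongs to the Sobolev space. -/
lemma memW_of_bounded {n : ℕ} {s : ℝ} {p : Rn n → Rn n → ℝ} {u φ : Rn n → ℝ} {pM L R : ℝ}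
    {x₀ : Rn n} (hn : 1 ≤ n) (hs : s ∈ Set.Ioo (0 : ℝ) 1)
    (hpc : Measurable fun z : Rn n × Rn n => p z.1 z.2)
    (hp : ∀ x y, 1 < p x y ∧ p x y ≤ pM) (hu : MemW s p u) (hφm : Measurable φ)
    (hφ0 : ∀ x, 0 ≤ φ x) (hφ1 : ∀ x, φ x ≤ 1) (hφB : ∀ x, x ∉ ball x₀ R → φ x = 0)
    (hL : 1 ≤ L) (hφL : ∀ x y, |φ x - φ y| ≤ |u x - u y| + L * ‖x - y‖) : MemW s p φ := by
  set B : Set (Rn n) := ball x₀ R with hB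
  have hBm : MeasurableSet B := measurableSet_ball
  have hBf : volume B < ⊤ := measure_ball_lt_top
  refine ⟨hφm, ?_, ?_⟩
  · refine lt_of_le_of_lt (lintegral_mono (g := B.indicator 1) fun x => ?_) ?_
    · by_cases hx : x ∈ B
      · rw [indicator_of_mem hx, abs_of_nonneg (hφ0 x)]
        exact ENNReal.ofReal_le_one.2 (Real.rpow_le_one (hφ0 x) (hφ1 x) (by linarith [hp x x]))
      · rw [hφB x hx, abs_zero, Real.zero_rpow (by linarith [hp x x])]
        simp
    · rw [lintegral_indicator_one hBm]; exact hBf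
  · set C : ℝ := (2 * L) ^ pM with hC
    have hC0 : 0 ≤ C := by positivity
    have hpM : 0 ≤ pM := by linarith [hp x₀ x₀]
    have hC1 : 1 ≤ C := Real.one_le_rpow (by linarith) hpM
    have hpt : ∀ x y, ENNReal.ofReal (|φ x - φ y| ^ p x y / ‖x - y‖ ^ ((n : ℝ) + s * p x y)) ≤
        ENNReal.ofReal C * (ENNReal.ofReal (|u x - u y| ^ p x y
          / ‖x - y‖ ^ ((n : ℝ) + s * p x y)) +
          (B.indicator 1 x * ENNReal.ofReal (kern n s (x - y)) +
            B.indicator 1 y * ENNReal.ofReal (kern n s (y - x)))) := by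
      intro x y
      obtain ⟨hp1, hp2⟩ := hp x y
      set N := ‖x - y‖ ^ ((n : ℝ) + s * p x y) with hN
      have hN0 : 0 ≤ N := by positivity
      have hkk : kern n s (y - x) = kern n s (x - y) := by rw [← kern_neg, neg_sub]
      have hk0 : 0 ≤ kern n s (x - y) := kern_nonneg _
      by_cases hxy : x ∉ B ∧ y ∉ B
      · rw [hφB x hxy.1, hφB y hxy.2, sub_zero, abs_zero, Real.zero_rpow (by linarith)]
        simp
      have hind : ENNReal.ofReal (kern n s (x - y)) ≤
          B.indicator 1 x * ENNReal.ofReal (kern n s (x - y)) +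
            B.indicator 1 y * ENNReal.ofReal (kern n s (y - x)) := by
        rw [hkk]
        by_cases hx : x ∈ B
        · rw [indicator_of_mem hx]; simp
        · have hy : y ∈ B := by tauto
          rw [indicator_of_mem hy]; simp
      refine le_trans ?_ (mul_le_mul_right (add_le_add_right hind _) _)
      rw [← ENNReal.ofReal_add (by positivity) hk0, ← ENNReal.ofReal_mul hC0]
      apply ENNReal.ofReal_le_ofReal
      have hu0 : 0 ≤ |u x - u y| ^ p x y / N := by positivity
      rcases lt_or_ge ‖x - y‖ 1 with hz | hz
      · have hk := norm_rpow_div_le_kern (n := n) hs.2 hp1.le hz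
        have h1 : |φ x - φ y| ≤ 2 * L * max |u x - u y| ‖x - y‖ := by
          refine (hφL x y).trans ?_
          have := le_max_left |u x - u y| ‖x - y‖
          have := le_max_right |u x - u y| ‖x - y‖
          have := abs_nonneg (u x - u y)
          nlinarith
        have hm0 : 0 ≤ max |u x - u y| ‖x - y‖ := le_max_of_le_left (abs_nonneg _)
        have h2 : |φ x - φ y| ^ p x y ≤ C * (|u x - u y| ^ p x y + ‖x - y‖ ^ p x y) := by
          refine (Real.rpow_le_rpow (abs_nonneg _) h1 (by linarith)).trans ?_
          rw [Real.mul_rpow (by linarith) hm0]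
          refine mul_le_mul (Real.rpow_le_rpow_of_exponent_le (by linarith) hp2) ?_
            (Real.rpow_nonneg hm0 _) hC0
          rcases max_cases |u x - u y| ‖x - y‖ with h | h <;> rw [h.1]
          · linarith [Real.rpow_nonneg (norm_nonneg (x - y)) (p x y)]
          · linarith [Real.rpow_nonneg (abs_nonneg (u x - u y)) (p x y)]
        calc |φ x - φ y| ^ p x y / N
            ≤ C * (|u x - u y| ^ p x y + ‖x - y‖ ^ p x y) / N :=
              div_le_div_of_nonneg_right h2 hN0
          _ = C * (|u x - u y| ^ p x y / N + ‖x - y‖ ^ p x y / N) := by ring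
          _ ≤ _ := by gcongr
      · have hk := one_div_norm_rpow_le_kern (n := n) hs.1 hp1.le hz
        have h1 : |φ x - φ y| ≤ 1 := by
          rw [abs_le]; constructor <;> linarith [hφ0 x, hφ0 y, hφ1 x, hφ1 y]
        have h2 : |φ x - φ y| ^ p x y ≤ 1 :=
          Real.rpow_le_one (abs_nonneg _) h1 (by linarith)
        calc |φ x - φ y| ^ p x y / N ≤ 1 / N := div_le_div_of_nonneg_right h2 hN0
          _ ≤ kern n s (x - y) := hk
          _ ≤ C * (|u x - u y| ^ p x y / N + kern n s (x - y)) := by nlinarith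
    refine lt_of_le_of_lt (lintegral_mono fun x => lintegral_mono fun y => hpt x y) ?_
    have hkm : Measurable (kern n s) := measurable_kern
    have hindm : Measurable (B.indicator (1 : Rn n → ℝ≥0∞)) := measurable_one.indicator hBm
    have hm1 : Measurable fun z : Rn n × Rn n => ENNReal.ofReal (|u z.1 - u z.2| ^ p z.1 z.2
          / ‖z.1 - z.2‖ ^ ((n : ℝ) + s * p z.1 z.2)) :=
      (measurable_seminorm_integrand hpc hu.1).ennreal_ofReal
    have hm2 : Measurable fun z : Rn n × Rn n =>
        B.indicator 1 z.1 * ENNReal.ofReal (kern n s (z.1 - z.2)) := by fun_prop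
    have hm3 : Measurable fun z : Rn n × Rn n =>
        B.indicator 1 z.2 * ENNReal.ofReal (kern n s (z.2 - z.1)) := by fun_prop
    have hfin := lintegral_indicator_kern_lt_top hn hs hBm hBf
    have hswap : ∫⁻ x, ∫⁻ y, B.indicator 1 y * ENNReal.ofReal (kern n s (y - x)) =
        ∫⁻ x, ∫⁻ y, B.indicator 1 x * ENNReal.ofReal (kern n s (x - y)) :=
      lintegral_lintegral_swap hm3.aemeasurable
    rw [lintegral_lintegral_const_mul_add_add ENNReal.ofReal_ne_top hm1 hm2, hswap]
    exact ENNReal.mul_lt_top ENNReal.ofReal_lt_top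
      (ENNReal.add_lt_top.2 ⟨hu.2.2, ENNReal.add_lt_top.2 ⟨hfin, hfin⟩⟩)

/-- The test function: a truncation of `u` times a power of a cutoff. -/
def testFn {n : ℕ} (β k : ℝ) (q : ℕ) (x₀ : Rn n) (ρ d : ℝ) (u : Rn n → ℝ) (x : Rn n) : ℝ :=
  trunc β k (u x) * cutoff x₀ ρ d x ^ q

/-- The error produced by testing with `testFn`, supported in the superlevel set `A`. -/
def errTerm {n : ℕ} (s : ℝ) (p : Rn n → Rn n → ℝ) (u : Rn n → ℝ) (A : Set (Rn n))
    (Q M k : ℝ) (x y : Rn n) : ℝ :=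
  A.indicator (fun x => Q * ((1 + u x - k) ^ M * kern n s (x - y)
    + |u y| ^ (p x y - 1) / (1 + ‖y‖ ^ ((n : ℝ) + s * p x y)))) x

section TestFn

variable {n : ℕ} {s : ℝ} {p : Rn n → Rn n → ℝ} {u : Rn n → ℝ} {β k : ℝ} {q : ℕ}
  {x₀ : Rn n} {ρ d : ℝ}

lemma testFn_nonneg (hβ : 0 < β) (x : Rn n) : 0 ≤ testFn β k q x₀ ρ d u x :=
  mul_nonneg (trunc_nonneg hβ _) (pow_nonneg (cutoff_nonneg x) _)

lemma testFn_le_one (x : Rn n) : testFn β k q x₀ ρ d u x ≤ 1 :=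
  mul_le_one₀ (trunc_le_one _) (pow_nonneg (cutoff_nonneg x) _)
    (pow_le_one₀ (cutoff_nonneg x) (cutoff_le_one x))

lemma of_testFn_ne_zero (hd : 0 < d) (hq : q ≠ 0) {x : Rn n}
    (h : testFn β k q x₀ ρ d u x ≠ 0) : k < u x ∧ dist x x₀ < ρ + 2 * d / 3 := by
  rw [testFn, mul_ne_zero_iff, pow_ne_zero_iff hq] at h
  exact ⟨lt_of_trunc_ne_zero h.1, dist_lt_of_cutoff_ne_zero hd h.2⟩

lemma measurable_testFn (hu : Measurable u) : Measurable (testFn β k q x₀ ρ d u) := by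
  unfold testFn
  exact (measurable_trunc.comp hu).mul (measurable_cutoff.pow_const q)

lemma abs_testFn_sub_le (hβ : 0 < β) (hβ1 : β ≤ 1) (hd : 0 < d) (x y : Rn n) :
    |testFn β k q x₀ ρ d u x - testFn β k q x₀ ρ d u y|
      ≤ |u x - u y| + (q * (3 / d) + 1) * ‖x - y‖ := by
  have hG := abs_trunc_sub_le (k := k) hβ hβ1 (u x) (u y)
  have hc := abs_cutoff_sub_le (x₀ := x₀) (ρ := ρ) hd x y
  have hx0 := cutoff_nonneg (x₀ := x₀) (ρ := ρ) (d := d) x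
  have hy0 := cutoff_nonneg (x₀ := x₀) (ρ := ρ) (d := d) y
  have hx1 := cutoff_le_one (x₀ := x₀) (ρ := ρ) (d := d) x
  have hy1 := cutoff_le_one (x₀ := x₀) (ρ := ρ) (d := d) y
  have hpow := abs_pow_sub_pow_le (cutoff x₀ ρ d x) (cutoff x₀ ρ d y) q
  have hG0 := trunc_nonneg (k := k) hβ (u y)
  have hG1 := trunc_le_one (β := β) (k := k) (u y)
  unfold testFn
  set a := cutoff x₀ ρ d x
  set b := cutoff x₀ ρ d y
  have hpow' : |a ^ q - b ^ q| ≤ q * (3 / d * ‖x - y‖) := by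
    refine hpow.trans ?_
    have h1 : max |a| |b| ^ (q - 1) ≤ 1 := by
      rw [abs_of_nonneg hx0, abs_of_nonneg hy0]
      exact pow_le_one₀ (le_max_of_le_left hx0) (max_le hx1 hy1)
    calc |a - b| * q * max |a| |b| ^ (q - 1) ≤ |a - b| * q * 1 := by gcongr
      _ = q * |a - b| := by ring
      _ ≤ _ := by gcongr
  have ha1 : a ^ q ≤ 1 := pow_le_one₀ hx0 hx1
  have ha0 : 0 ≤ a ^ q := pow_nonneg hx0 _
  calc |trunc β k (u x) * a ^ q - trunc β k (u y) * b ^ q|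
      = |(trunc β k (u x) - trunc β k (u y)) * a ^ q + trunc β k (u y) * (a ^ q - b ^ q)| := by
        congr 1; ring
    _ ≤ |trunc β k (u x) - trunc β k (u y)| * a ^ q + trunc β k (u y) * |a ^ q - b ^ q| := by
        refine (abs_add_le _ _).trans ?_
        rw [abs_mul, abs_mul, abs_of_nonneg ha0, abs_of_nonneg hG0]
    _ ≤ |u x - u y| * 1 + 1 * (q * (3 / d * ‖x - y‖)) := by gcongr
    _ ≤ _ := by nlinarith [norm_nonneg (x - y)]

lemma memW_testFn {pM : ℝ} (hn : 1 ≤ n) (hs : s ∈ Set.Ioo (0 : ℝ) 1)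
    (hpc : Measurable fun z : Rn n × Rn n => p z.1 z.2)
    (hp : ∀ x y, 1 < p x y ∧ p x y ≤ pM) (hu : MemW s p u)
    (hβ : 0 < β) (hβ1 : β ≤ 1) (hd : 0 < d) (hq : q ≠ 0) :
    MemW s p (testFn β k q x₀ ρ d u) := by
  refine memW_of_bounded (x₀ := x₀) (R := ρ + 2 * d / 3) (L := q * (3 / d) + 1) hn hs hpc hp hu
    (measurable_testFn hu.1) (testFn_nonneg hβ) testFn_le_one (fun x hx => ?_) ?_
    (abs_testFn_sub_le hβ hβ1 hd)
  · by_contra h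
    exact hx (of_testFn_ne_zero hd hq h).2
  · have : 0 ≤ (q : ℝ) * (3 / d) := by positivity
    linarith

lemma measurable_errTerm {Q M : ℝ} {A : Set (Rn n)} (hA : MeasurableSet A)
    (hpc : Measurable fun z : Rn n × Rn n => p z.1 z.2) (hu : Measurable u) :
    Measurable fun z : Rn n × Rn n => errTerm s p u A Q M k z.1 z.2 := by
  have hkm : Measurable (kern n s) := measurable_kern
  have : (fun z : Rn n × Rn n => errTerm s p u A Q M k z.1 z.2) =
      (Prod.fst ⁻¹' A).indicator (fun z : Rn n × Rn n =>
        Q * ((1 + u z.1 - k) ^ M * kern n s (z.1 - z.2)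
        + |u z.2| ^ (p z.1 z.2 - 1) / (1 + ‖z.2‖ ^ ((n : ℝ) + s * p z.1 z.2)))) := by
    rfl
  rw [this]
  refine Measurable.indicator ?_ (measurable_fst hA)
  fun_prop

lemma errTerm_nonneg {Q M : ℝ} {A : Set (Rn n)} (hQ : 0 ≤ Q) (hA : ∀ x ∈ A, k < u x)
    (x y : Rn n) : 0 ≤ errTerm s p u A Q M k x y := by
  unfold errTerm
  refine indicator_apply_nonneg fun hx => ?_
  have h1 : 0 ≤ (1 + u x - k) ^ M := Real.rpow_nonneg (by linarith [hA x hx]) _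
  have h2 := kern_nonneg (s := s) (x - y)
  positivity

lemma lintegral_errTerm_le {Q M K T : ℝ} {A : Set (Rn n)} (hA : MeasurableSet A)
    (hQ : 0 ≤ Q) (hM : 0 ≤ M) (hK0 : 0 ≤ K) (hT0 : 0 ≤ T) (hAk : ∀ x ∈ A, k < u x)
    (hK : ∫⁻ z, ENNReal.ofReal (kern n s z) ≤ ENNReal.ofReal K)
    (hT : ∀ x ∈ A, ∫⁻ y, ENNReal.ofReal (|u y| ^ (p x y - 1) / (1 + ‖y‖ ^ ((n : ℝ) + s * p x y)))
      ≤ ENNReal.ofReal T) :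
    ∫⁻ x, ∫⁻ y, ENNReal.ofReal (errTerm s p u A Q M k x y) ≤
      ENNReal.ofReal (Q * (K + T)) * ∫⁻ x in A, ENNReal.ofReal ((1 + u x - k) ^ M) := by
  have hkm : Measurable (kern n s) := measurable_kern
  rw [← lintegral_const_mul' _ _ ENNReal.ofReal_ne_top, ← lintegral_indicator hA]
  refine lintegral_mono fun x => ?_
  by_cases hx : x ∈ A
  swap
  · simp [errTerm, indicator_of_notMem hx]
  have hU1 : 1 ≤ (1 + u x - k) ^ M := Real.one_le_rpow (by linarith [hAk x hx]) hM
  simp only [errTerm, indicator_of_mem hx]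
  have e1 : ∀ y, ENNReal.ofReal (Q * ((1 + u x - k) ^ M * kern n s (x - y)
      + |u y| ^ (p x y - 1) / (1 + ‖y‖ ^ ((n : ℝ) + s * p x y)))) =
      ENNReal.ofReal (Q * (1 + u x - k) ^ M) * ENNReal.ofReal (kern n s (x - y)) +
      ENNReal.ofReal Q * ENNReal.ofReal
        (|u y| ^ (p x y - 1) / (1 + ‖y‖ ^ ((n : ℝ) + s * p x y))) := by
    intro y
    have h2 := kern_nonneg (s := s) (x - y)
    rw [← ENNReal.ofReal_mul (by positivity), ← ENNReal.ofReal_mul hQ,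
      ← ENNReal.ofReal_add (by positivity) (by positivity)]
    congr 1; ring
  simp_rw [e1]
  rw [lintegral_add_left (by fun_prop), lintegral_const_mul' _ _ ENNReal.ofReal_ne_top,
    lintegral_const_mul' _ _ ENNReal.ofReal_ne_top, lintegral_kern_sub]
  calc _ ≤ ENNReal.ofReal (Q * (1 + u x - k) ^ M) * ENNReal.ofReal K
        + ENNReal.ofReal Q * ENNReal.ofReal T := by
        gcongr; exact hT x hx
    _ ≤ _ := by
        rw [← ENNReal.ofReal_mul (by positivity), ← ENNReal.ofReal_mul hQ,
          ← ENNReal.ofReal_mul (by positivity),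
          ← ENNReal.ofReal_add (by positivity) (by positivity)]
        apply ENNReal.ofReal_le_ofReal
        have : 0 ≤ Q * T := by positivity
        nlinarith

end TestFn

section Pointwise

variable {n : ℕ} {s : ℝ} {p : Rn n → Rn n → ℝ} {u : Rn n → ℝ} {β k : ℝ} {q : ℕ}
  {x₀ : Rn n} {ρ d : ℝ}

lemma one_add_rpow_le_mul {x z E e T : ℝ} (hT : 1 ≤ T) (hE : 0 ≤ E) (hEe : E ≤ e) (hx : 0 ≤ x)
    (hz : 0 ≤ z) (h1 : 1 ≤ T * z) (h2 : x ≤ T * z) :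
    1 + x ^ E ≤ 2 * T ^ e * z ^ E := by
  have h3 : (T * z) ^ E ≤ T ^ e * z ^ E := by
    rw [Real.mul_rpow (by linarith) hz]
    exact mul_le_mul_of_nonneg_right (Real.rpow_le_rpow_of_exponent_le hT hEe) (by positivity)
  have h4 : 1 ≤ (T * z) ^ E := Real.one_le_rpow h1 hE
  have h5 : x ^ E ≤ (T * z) ^ E := Real.rpow_le_rpow hx h2 hE
  linarith

set_option maxHeartbeats 800000 in
/-- Outside the error, the integrand of the weak formulation tested with `testFn` is
nonnegative. -/
lemma formIntegrand_add_errTerm_nonneg {pM M T : ℝ} {A : Set (Rn n)}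
    (hs : s ∈ Set.Ioo (0 : ℝ) 1) (hp : ∀ x y, 1 < p x y ∧ p x y ≤ pM)
    (hsymm : ∀ x y, p x y = p y x)
    (hβ : 0 < β) (hβ1 : β ≤ 1) (hq : pM ≤ q) (hk : 0 ≤ k) (hd : 0 < d) (hd1 : d ≤ 1)
    (hρd : ρ + d ≤ 1) (hA : A = {x | x ∈ ball x₀ (ρ + d) ∧ k < u x})
    (hpM : ∀ x ∈ ball x₀ (ρ + d), ∀ y ∈ ball x₀ (ρ + d), (1 + β) * (p x y - 1) ≤ M)
    (hT1 : 3 * q / (d * β) ≤ T) (hT2 : (4 + 3 * ‖x₀‖) / d ≤ T) (x y : Rn n) :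
    0 ≤ formIntegrand s p u (testFn β k q x₀ ρ d u) x y
      + errTerm s p u A (2 * T ^ ((n : ℝ) + pM)) M k x y
      + errTerm s p u A (2 * T ^ ((n : ℝ) + pM)) M k y x := by
  have hpM1 : 1 < pM := by linarith [hp x y]
  have hq0 : q ≠ 0 := by rintro rfl; norm_num at hq; linarith
  have hT : 1 ≤ T := by
    refine le_trans ?_ hT2
    rw [one_le_div hd]; linarith [norm_nonneg x₀]
  have hAk : ∀ x ∈ A, k < u x := fun x hx => by rw [hA] at hx; exact hx.2
  have hQ : 0 ≤ 2 * T ^ ((n : ℝ) + pM) := by positivity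
  set Q := 2 * T ^ ((n : ℝ) + pM) with hQd
  wlog hxy : u y ≤ u x generalizing x y
  · have := this y x (not_le.1 hxy).le
    rw [formIntegrand_symm hsymm]
    linarith
  have he1 := errTerm_nonneg (s := s) (p := p) (M := M) hQ hAk x y
  have he2 := errTerm_nonneg (s := s) (p := p) (M := M) hQ hAk y x
  obtain ⟨hp1, hp2⟩ := hp x y
  set φ := testFn β k q x₀ ρ d u with hφ
  have hN : 0 ≤ ‖x - y‖ ^ ((n : ℝ) + s * p x y) := by positivity
  have hab : |u x - u y| ^ (p x y - 2) * (u x - u y) = (u x - u y) ^ (p x y - 1) := by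
    conv_lhs => rw [abs_rpow_sub_two_mul hp1 (sub_nonneg.2 hxy)]
  have hD : 0 ≤ (u x - u y) ^ (p x y - 1) := Real.rpow_nonneg (sub_nonneg.2 hxy) _
  by_cases hneg : φ y ≤ φ x
  · have : 0 ≤ formIntegrand s p u φ x y := by
      rw [formIntegrand, hab]
      exact div_nonneg (mul_nonneg hD (sub_nonneg.2 hneg)) hN
    linarith
  push Not at hneg
  have hφx0 : 0 ≤ φ x := testFn_nonneg hβ x
  have hφy1 : φ y ≤ 1 := testFn_le_one y
  obtain ⟨hyk, hyd⟩ := of_testFn_ne_zero hd hq0 (by linarith : φ y ≠ 0)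
  have hyA : y ∈ A := by
    rw [hA]; exact ⟨mem_ball.2 (by linarith), hyk⟩
  have hF : -formIntegrand s p u φ x y =
      (u x - u y) ^ (p x y - 1) * (φ y - φ x) / ‖x - y‖ ^ ((n : ℝ) + s * p x y) := by
    rw [formIntegrand, hab]; ring
  rcases lt_or_ge ‖x - y‖ (d / 3) with hz | hz
  · have hxB : x ∈ ball x₀ (ρ + d) := by
      rw [mem_ball]
      have := dist_triangle x y x₀
      rw [dist_eq_norm x y] at this
      linarith
    have hyB : y ∈ ball x₀ (ρ + d) := mem_ball.2 (by linarith)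
    have hxA : x ∈ A := by rw [hA]; exact ⟨hxB, by linarith⟩
    have hX1 : 1 ≤ 1 + u x - k := by linarith
    have hnear := near_lower (k := k) hβ hβ1 hp1 (hp2.trans hq) (cutoff_nonneg x)
      (cutoff_nonneg y) (cutoff_le_one y) hxy hneg
    have hmax : max (u x - k) 0 + 1 = 1 + u x - k := by
      rw [max_eq_left (by linarith)]; ring
    rw [hmax] at hnear
    have hkern := norm_rpow_div_le_kern (n := n) (z := x - y) hs.2 hp1.le (by linarith)
    have hk0 : 0 ≤ kern n s (x - y) := kern_nonneg _
    have hc := abs_cutoff_sub_le (x₀ := x₀) (ρ := ρ) hd x y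
    have h1 : (q * |cutoff x₀ ρ d x - cutoff x₀ ρ d y| / β) ^ p x y ≤
        T ^ ((n : ℝ) + pM) * ‖x - y‖ ^ p x y := by
      have e1 : q * |cutoff x₀ ρ d x - cutoff x₀ ρ d y| / β ≤ T * ‖x - y‖ := by
        calc _ ≤ q * (3 / d * ‖x - y‖) / β := by gcongr
          _ = 3 * q / (d * β) * ‖x - y‖ := by field_simp
          _ ≤ _ := by gcongr
      refine (Real.rpow_le_rpow (by positivity) e1 (by linarith)).trans ?_
      rw [Real.mul_rpow (by linarith) (norm_nonneg _)]
      refine mul_le_mul_of_nonneg_right (Real.rpow_le_rpow_of_exponent_le hT ?_) (by positivity)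
      have : (0 : ℝ) ≤ n := Nat.cast_nonneg n
      linarith
    have h2 : (1 + u x - k) ^ ((1 + β) * (p x y - 1)) ≤ (1 + u x - k) ^ M :=
      Real.rpow_le_rpow_of_exponent_le hX1 (hpM x hxB y hyB)
    have hU0 : 0 ≤ (1 + u x - k) ^ M := Real.rpow_nonneg (by linarith) _
    have h3 : -formIntegrand s p u φ x y ≤ errTerm s p u A Q M k x y := by
      rw [hF, errTerm, indicator_of_mem hxA]
      calc _ ≤ (T ^ ((n : ℝ) + pM) * ‖x - y‖ ^ p x y) * (1 + u x - k) ^ M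
            / ‖x - y‖ ^ ((n : ℝ) + s * p x y) := by
            refine div_le_div_of_nonneg_right (hnear.trans ?_) hN
            exact mul_le_mul h1 h2 (Real.rpow_nonneg (by linarith) _) (by positivity)
        _ = T ^ ((n : ℝ) + pM) * ((1 + u x - k) ^ M *
            (‖x - y‖ ^ p x y / ‖x - y‖ ^ ((n : ℝ) + s * p x y))) := by ring
        _ ≤ Q * ((1 + u x - k) ^ M * kern n s (x - y) + |u y| ^ (p x y - 1) /
            (1 + ‖y‖ ^ ((n : ℝ) + s * p x y))) := by
            have : 0 ≤ |u y| ^ (p x y - 1) / (1 + ‖y‖ ^ ((n : ℝ) + s * p x y)) := by positivity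
            refine mul_le_mul ?_ ?_ (by positivity) hQ
            · rw [hQd]; linarith [Real.rpow_nonneg (by linarith : 0 ≤ T) ((n : ℝ) + pM)]
            · have := mul_le_mul_of_nonneg_left hkern hU0
              linarith
    linarith
  · have hzpos : 0 < ‖x - y‖ := by linarith
    have hpow : 1 + ‖x‖ ^ ((n : ℝ) + s * p y x) ≤ Q * ‖x - y‖ ^ ((n : ℝ) + s * p y x) := by
      have hp3 := hp y x
      have hTz : (4 + 3 * ‖x₀‖) / d * ‖x - y‖ ≤ T * ‖x - y‖ := by gcongr
      have h33 : 1 ≤ 3 / d * ‖x - y‖ := by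
        rw [div_mul_eq_mul_div, one_le_div hd]; linarith
      have h43 : (4 + 3 * ‖x₀‖) / d * ‖x - y‖ = 1 / d * ‖x - y‖
          + (1 + ‖x₀‖) * (3 / d * ‖x - y‖) := by ring
      have h1d : ‖x - y‖ ≤ 1 / d * ‖x - y‖ := by
        have : 1 ≤ 1 / d := by rw [one_le_div hd]; exact hd1
        nlinarith
      have hnx : ‖x‖ ≤ ‖x - y‖ + (1 + ‖x₀‖) := by
        have e1 : ‖x‖ ≤ ‖x - y‖ + ‖y‖ := by
          have := norm_add_le (x - y) y; rwa [sub_add_cancel] at this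
        have e2 : ‖y‖ ≤ dist y x₀ + ‖x₀‖ := by
          rw [dist_eq_norm]
          have := norm_add_le (y - x₀) x₀; rwa [sub_add_cancel] at this
        linarith
      have hx00 := norm_nonneg x₀
      have hmul : (1 + ‖x₀‖) * 1 ≤ (1 + ‖x₀‖) * (3 / d * ‖x - y‖) :=
        mul_le_mul_of_nonneg_left h33 (by linarith)
      refine one_add_rpow_le_mul hT ?_ ?_ (norm_nonneg _) hzpos.le ?_ ?_
      · have := hs.1; have : 0 ≤ s * p y x := by nlinarith
        positivity
      · have : s * p y x ≤ pM := by nlinarith [hs.1, hs.2]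
        linarith
      · linarith
      · linarith
    have hux : u x - u y ≤ |u x| := by linarith [le_abs_self (u x)]
    have h3 : -formIntegrand s p u φ x y ≤ errTerm s p u A Q M k y x := by
      rw [hF, errTerm, indicator_of_mem hyA, hsymm y x]
      rw [hsymm y x] at hpow
      have hU0 : 0 ≤ (1 + u y - k) ^ M := Real.rpow_nonneg (by linarith) _
      have hk0 : 0 ≤ kern n s (y - x) := kern_nonneg _
      have hNpos : 0 < ‖x - y‖ ^ ((n : ℝ) + s * p x y) := Real.rpow_pos_of_pos hzpos _
      have hW : 0 < 1 + ‖x‖ ^ ((n : ℝ) + s * p x y) := by positivity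
      have hnum : (u x - u y) ^ (p x y - 1) * (φ y - φ x) ≤ |u x| ^ (p x y - 1) := by
        have := Real.rpow_le_rpow (sub_nonneg.2 hxy) hux (by linarith : 0 ≤ p x y - 1)
        exact (mul_le_of_le_one_right hD (by linarith)).trans this
      calc _ ≤ |u x| ^ (p x y - 1) / ‖x - y‖ ^ ((n : ℝ) + s * p x y) :=
            div_le_div_of_nonneg_right hnum hN
        _ ≤ Q * (|u x| ^ (p x y - 1) / (1 + ‖x‖ ^ ((n : ℝ) + s * p x y))) := by
            rw [mul_div_assoc', div_le_div_iff₀ hNpos hW]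
            calc |u x| ^ (p x y - 1) * (1 + ‖x‖ ^ ((n : ℝ) + s * p x y))
                ≤ |u x| ^ (p x y - 1) * (Q * ‖x - y‖ ^ ((n : ℝ) + s * p x y)) :=
                  mul_le_mul_of_nonneg_left hpow (by positivity)
              _ = _ := by ring
        _ ≤ _ := by
            refine mul_le_mul_of_nonneg_left ?_ hQ
            have := mul_nonneg hU0 hk0
            linarith
    linarith

end Pointwise

section Step

variable {n : ℕ} {s : ℝ} {p : Rn n → Rn n → ℝ} {u : Rn n → ℝ} {β k : ℝ} {q : ℕ}
  {x₀ : Rn n} {ρ d : ℝ}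

/-- Chebyshev's inequality for powers on superlevel sets. -/
lemma measure_inter_le_of_lintegral_rpow_le {X : Type*} [MeasurableSpace X] {μ : Measure X}
    {A : Set X} (hA : MeasurableSet A) {f : X → ℝ} (hf : Measurable f) {M Y t : ℝ}
    (hM : 0 ≤ M) (ht : 0 < t)
    (hY : ∫⁻ x in A, ENNReal.ofReal (f x ^ M) ∂μ ≤ ENNReal.ofReal Y) :
    μ (A ∩ {x | t ≤ f x}) ≤ ENNReal.ofReal (Y / t ^ M) := by
  have hS : MeasurableSet (A ∩ {x | t ≤ f x}) := hA.inter (measurableSet_le measurable_const hf)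
  have htM : 0 < t ^ M := Real.rpow_pos_of_pos ht M
  rw [ENNReal.ofReal_div_of_pos htM,
    ENNReal.le_div_iff_mul_le (Or.inl (ENNReal.ofReal_pos.2 htM).ne')
      (Or.inl ENNReal.ofReal_ne_top), mul_comm, ← setLIntegral_const]
  refine le_trans ?_ hY
  refine le_trans (setLIntegral_mono' hS fun x hx => ?_) (lintegral_mono_set inter_subset_left)
  exact ENNReal.ofReal_le_ofReal (Real.rpow_le_rpow ht.le hx.2 hM)

/-- Pointwise lower bound for the integrand of the tested weak formulation at pairs of points
where `u` takes substantially different values. -/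
lemma le_formIntegrand_testFn {pl pM g r : ℝ} (hs : s ∈ Set.Ioo (0 : ℝ) 1)
    (hp : ∀ x y, 1 < p x y ∧ p x y ≤ pM) (hβ : 0 < β) (hβ1 : β ≤ 1) (hd : 0 < d)
    (hg : 0 < g) (hg1 : g ≤ 1) (hr1 : r ≤ 1) (hrd : r ≤ d / 3) {x y : Rn n}
    (hpl : pl ≤ p x y) (hx : dist x x₀ < ρ) (hxk : k + g < u x) (hy : dist y x < r)
    (hyu : u y - k ≤ (u x - k) / 2) :
    β * (g / 4) ^ pM * (1 + u x - k) ^ (pl - 1 - β) / r ^ ((n : ℝ) + s)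
      ≤ formIntegrand s p u (testFn β k q x₀ ρ d u) x y := by
  obtain ⟨hp1, hp2⟩ := hp x y
  have hxc : cutoff x₀ ρ d x = 1 := cutoff_eq_one hd (by linarith)
  have hyc : cutoff x₀ ρ d y = 1 :=
    cutoff_eq_one hd (by linarith [dist_triangle y x x₀])
  set U := 1 + u x - k with hU
  have hU1 : 1 ≤ U := by linarith
  have hU0 : 0 < U := by linarith
  have hgU : g * U / 4 ≤ (U - 1) / 2 := by nlinarith
  have hdiff : g * U / 4 ≤ u x - u y := by linarith
  have hgU0 : 0 < g * U / 4 := by positivity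
  have hxy : u y ≤ u x := by linarith
  have htr : β * U ^ (-β) * (g / 4) ≤ testFn β k q x₀ ρ d u x - testFn β k q x₀ ρ d u y := by
    simp only [testFn, hxc, hyc, one_pow, mul_one]
    refine le_trans ?_ (trunc_sub_ge (k := k) hβ hβ1 hxy)
    have e1 : max (u x - k) 0 = U - 1 := by rw [max_eq_left (by linarith)]; ring
    have e2 : max (u y - k) 0 ≤ (U - 1) / 2 := max_le (by linarith) (by linarith)
    rw [e1, sub_add_cancel, Real.rpow_sub_one hU0.ne']
    have h1 : 0 ≤ U ^ (-β) := Real.rpow_nonneg hU0.le _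
    calc β * U ^ (-β) * (g / 4) = β * (U ^ (-β) / U) * (g * U / 4) := by field_simp
      _ ≤ _ := by
        refine mul_le_mul_of_nonneg_left (by linarith) (by positivity)
  have hz0 : 0 < ‖x - y‖ := by
    rw [norm_pos_iff, sub_ne_zero]
    rintro rfl
    linarith
  have hzr : ‖x - y‖ ≤ r := by rw [← dist_eq_norm, dist_comm]; exact hy.le
  have hr0 : 0 < r := hz0.trans_le hzr
  have hN : ‖x - y‖ ^ ((n : ℝ) + s * p x y) ≤ r ^ ((n : ℝ) + s) := by
    have hn0 : (0 : ℝ) ≤ n := Nat.cast_nonneg n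
    refine (Real.rpow_le_rpow hz0.le hzr (by nlinarith [hs.1])).trans ?_
    exact Real.rpow_le_rpow_of_exponent_ge hr0 hr1 (by nlinarith [hs.1])
  have hab : |u x - u y| ^ (p x y - 2) * (u x - u y) = (u x - u y) ^ (p x y - 1) :=
    abs_rpow_sub_two_mul hp1 (sub_nonneg.2 hxy)
  have hnum : β * (g / 4) ^ pM * U ^ (pl - 1 - β) ≤ (u x - u y) ^ (p x y - 1) *
      (testFn β k q x₀ ρ d u x - testFn β k q x₀ ρ d u y) := by
    have h1 : (g * U / 4) ^ (p x y - 1) ≤ (u x - u y) ^ (p x y - 1) :=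
      Real.rpow_le_rpow hgU0.le hdiff (by linarith)
    have h0 : 0 ≤ β * U ^ (-β) * (g / 4) := by positivity
    refine le_trans ?_ (mul_le_mul h1 htr h0 (by positivity))
    have e1 : (g * U / 4) ^ (p x y - 1) * (β * U ^ (-β) * (g / 4)) =
        β * (g / 4) ^ p x y * U ^ (p x y - 1 - β) := by
      rw [show g * U / 4 = (g / 4) * U by ring, Real.mul_rpow (by positivity) hU0.le,
        show p x y - 1 - β = (p x y - 1) + (-β) by ring, Real.rpow_add hU0,
        Real.rpow_sub_one (by positivity : g / 4 ≠ 0)]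
      field_simp
    rw [e1]
    have h2 : (g / 4) ^ pM ≤ (g / 4) ^ p x y :=
      Real.rpow_le_rpow_of_exponent_ge (by positivity) (by linarith) hp2
    have h3 : U ^ (pl - 1 - β) ≤ U ^ (p x y - 1 - β) :=
      Real.rpow_le_rpow_of_exponent_le hU1 (by linarith)
    gcongr
  rw [formIntegrand, hab]
  have hnum0 : 0 ≤ β * (g / 4) ^ pM * U ^ (pl - 1 - β) := by positivity
  exact div_le_div₀ (hnum0.trans hnum) hnum (Real.rpow_pos_of_pos hz0 _) hN

lemma exists_radius (hn : 1 ≤ n) {w m d : ℝ} (hw : 0 < w) (hm : 0 < m) (hd : 0 < d)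
    (h : m ≤ w * (d / 3) ^ n) : ∃ r, 0 < r ∧ r ≤ d / 3 ∧ w * r ^ n = m ∧
      ∀ s : ℝ, r ^ (-s) = (m / w) ^ (-(s / n)) := by
  have hn0 : (n : ℝ) ≠ 0 := by positivity
  have hmw : 0 < m / w := by positivity
  have hrn : ((m / w) ^ (1 / (n : ℝ))) ^ n = m / w := by
    rw [← Real.rpow_natCast, ← Real.rpow_mul hmw.le, one_div_mul_cancel hn0, Real.rpow_one]
  refine ⟨(m / w) ^ (1 / (n : ℝ)), Real.rpow_pos_of_pos hmw _, ?_, ?_, fun s => ?_⟩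
  · refine le_of_pow_le_pow_left₀ (by omega : n ≠ 0) (by positivity) ?_
    rw [hrn, div_le_iff₀ hw]; linarith
  · rw [hrn]; field_simp
  · rw [← Real.rpow_mul hmw.le]; congr 1; field_simp

/-- Volume of the unit ball, as a real number. -/
def unitVol (n : ℕ) : ℝ := (volume (ball (0 : Rn n) 1)).toReal

lemma unitVol_pos : 0 < unitVol n :=
  ENNReal.toReal_pos (measure_ball_pos _ _ one_pos).ne' measure_ball_lt_top.ne

lemma volume_ball_eq (x : Rn n) {r : ℝ} (hr : 0 < r) :
    volume (ball x r) = ENNReal.ofReal (unitVol n * r ^ n) := by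
  rw [Measure.addHaar_ball_of_pos volume x hr, finrank_euclideanSpace_fin, mul_comm,
    ENNReal.ofReal_mul unitVol_pos.le, unitVol, ENNReal.ofReal_toReal measure_ball_lt_top.ne]

/-- Lower bound for the inner integral at a point where `u` exceeds the level `k` by `g`. -/
lemma le_lintegral_of_level {pl pM M Y g : ℝ} {A : Set (Rn n)} {e : Rn n → Rn n → ℝ}
    (hn : 1 ≤ n) (hs : s ∈ Set.Ioo (0 : ℝ) 1)
    (hp : ∀ x y, 1 < p x y ∧ p x y ≤ pM) (hu : Measurable u)
    (hβ : 0 < β) (hβ1 : β ≤ 1) (hd : 0 < d) (hd1 : d ≤ 1)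
    (hA : A = {x | x ∈ ball x₀ (ρ + d) ∧ k < u x}) (hM : 0 ≤ M)
    (hpl : ∀ x ∈ ball x₀ (ρ + d), ∀ y ∈ ball x₀ (ρ + d), pl ≤ p x y)
    (hexp : M ≤ pl - 1 - β + M * s / n)
    (hg : 0 < g) (hg1 : g ≤ 1) (hYpos : 0 < Y)
    (hY : ∫⁻ x in A, ENNReal.ofReal ((1 + u x - k) ^ M) ≤ ENNReal.ofReal Y)
    (hYs : 2 ^ (M + 1) * Y ≤ unitVol n * (d / 3) ^ n)
    (he : ∀ x y, 0 ≤ e x y) {x : Rn n} (hx : dist x x₀ < ρ) (hxk : k + g < u x) :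
    ENNReal.ofReal (β * (g / 4) ^ pM * (unitVol n / 2) *
        (2 ^ (M + 1) * Y / unitVol n) ^ (-(s / n)) * (1 + u x - k) ^ M)
      ≤ ∫⁻ y, ENNReal.ofReal (formIntegrand s p u (testFn β k q x₀ ρ d u) x y + e x y + e y x) := by
  have hw : 0 < unitVol n := unitVol_pos
  set w := unitVol n with hwd
  set U := 1 + u x - k with hU
  have hU1 : 1 ≤ U := by linarith
  have hU0 : 0 < U := by linarith
  have hAm : MeasurableSet A := by
    rw [hA]; exact measurableSet_ball.inter (measurableSet_lt measurable_const hu)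
  set m := 2 ^ (M + 1) * Y * U ^ (-M) with hm
  have hm0 : 0 < m := by positivity
  obtain ⟨r, hr0, hrd, hrn, hrs⟩ := exists_radius hn hw hm0 hd (by
    refine le_trans ?_ hYs
    rw [hm]
    exact mul_le_of_le_one_right (by positivity)
      (Real.rpow_le_one_of_one_le_of_nonpos hU1 (by linarith)))
  set D := A ∩ {y | U / 2 ≤ 1 + u y - k} with hD
  have hf : Measurable fun y => 1 + u y - k := by fun_prop
  have hDm : MeasurableSet D := hAm.inter (measurableSet_le measurable_const hf)
  have hDv : volume D ≤ ENNReal.ofReal (m / 2) := by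
    refine (measure_inter_le_of_lintegral_rpow_le hAm hf hM (by positivity) hY).trans ?_
    apply ENNReal.ofReal_le_ofReal
    apply le_of_eq
    rw [hm, Real.div_rpow hU0.le (by norm_num), Real.rpow_add_one (by norm_num),
      Real.rpow_neg hU0.le]
    field_simp
  have hGv : ENNReal.ofReal (m / 2) ≤ volume (ball x r \ D) := by
    refine le_trans ?_ (le_measure_sdiff)
    rw [volume_ball_eq x hr0, ← hwd, hrn]
    refine le_trans ?_ (tsub_le_tsub_left hDv _)
    rw [← ENNReal.ofReal_sub _ (by positivity)]
    apply ENNReal.ofReal_le_ofReal; linarith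
  have hGm : MeasurableSet (ball x r \ D) := measurableSet_ball.diff hDm
  set c := β * (g / 4) ^ pM * U ^ (pl - 1 - β) / r ^ ((n : ℝ) + s) with hc
  have hc0 : 0 ≤ c := by positivity
  have hpt : ∀ y ∈ ball x r \ D, ENNReal.ofReal c ≤ ENNReal.ofReal
      (formIntegrand s p u (testFn β k q x₀ ρ d u) x y + e x y + e y x) := by
    intro y hy
    apply ENNReal.ofReal_le_ofReal
    have hyr : dist y x < r := hy.1
    have hyB : y ∈ ball x₀ (ρ + d) := by
      rw [mem_ball]; linarith [dist_triangle y x x₀]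
    have hyu : u y - k ≤ (u x - k) / 2 := by
      by_contra! h
      refine hy.2 ⟨?_, ?_⟩
      · rw [hA]; exact ⟨hyB, by linarith⟩
      · change U / 2 ≤ 1 + u y - k
        linarith
    have := le_formIntegrand_testFn (q := q) hs hp hβ hβ1 hd hg hg1 (by linarith) hrd
      (hpl x (mem_ball.2 (by linarith)) y hyB) hx hxk hyr hyu
    linarith [he x y, he y x]
  refine le_trans ?_ (setLIntegral_le_lintegral (ball x r \ D) _)
  refine le_trans ?_ (setLIntegral_mono' hGm hpt)
  rw [setLIntegral_const]
  refine le_trans ?_ (mul_le_mul_right hGv _)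
  rw [← ENNReal.ofReal_mul hc0]
  apply ENNReal.ofReal_le_ofReal
  have hrs' : r ^ (-s) = (2 ^ (M + 1) * Y / w) ^ (-(s / n)) * U ^ (M * s / n) := by
    rw [hrs s, hm, show 2 ^ (M + 1) * Y * U ^ (-M) / w = 2 ^ (M + 1) * Y / w * U ^ (-M) by ring,
      Real.mul_rpow (by positivity) (by positivity), ← Real.rpow_mul hU0.le]
    congr 2; ring
  have hcm : c * (m / 2) = β * (g / 4) ^ pM * (w / 2) * (2 ^ (M + 1) * Y / w) ^ (-(s / n)) *
      U ^ (pl - 1 - β + M * s / n) := by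
    rw [hc, ← hrn, Real.rpow_add hr0, Real.rpow_natCast, Real.rpow_add hU0]
    rw [Real.rpow_neg hr0.le] at hrs'
    have : r ^ n ≠ 0 := by positivity
    have : r ^ s ≠ 0 := by positivity
    calc _ = β * (g / 4) ^ pM * U ^ (pl - 1 - β) * (w / 2) * (r ^ s)⁻¹ := by
            field_simp
      _ = _ := by rw [hrs']; ring
  rw [hcm]
  exact mul_le_mul_of_nonneg_left (Real.rpow_le_rpow_of_exponent_le hU1 hexp) (by positivity)

end Step

section LevelStep

variable {n : ℕ} {s : ℝ} {p : Rn n → Rn n → ℝ} {u : Rn n → ℝ} {β : ℝ} {x₀ : Rn n} {Ω : Set (Rn n)}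

/-- Energy bound obtained by testing the equation with `testFn`. -/
lemma lintegral_formIntegrand_testFn_le {pM M T K Mt Y k ρ d : ℝ} {q : ℕ} {A : Set (Rn n)}
    (hn : 1 ≤ n) (hs : s ∈ Set.Ioo (0 : ℝ) 1)
    (hpc : Measurable fun z : Rn n × Rn n => p z.1 z.2)
    (hp : ∀ x y, 1 < p x y ∧ p x y ≤ pM) (hsymm : ∀ x y, p x y = p y x)
    (hu : MemW s p u) (hsub : IsWeakSubsol s p Ω u)
    (hMt : 0 ≤ Mt) (htail : ∀ x ∈ Ω,
      (∫⁻ y, ENNReal.ofReal (|u y| ^ (p x y - 1) / (1 + ‖y‖ ^ ((n : ℝ) + s * p x y))))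
        ≤ ENNReal.ofReal Mt)
    (hK0 : 0 ≤ K) (hK : ∫⁻ z, ENNReal.ofReal (kern n s z) ≤ ENNReal.ofReal K)
    (hβ : 0 < β) (hβ1 : β ≤ 1) (hq : pM ≤ q) (hk : 0 ≤ k) (hd : 0 < d) (hd1 : d ≤ 1)
    (hρd : ρ + d ≤ 1) (hΩ : ball x₀ (ρ + d) ⊆ Ω) (hA : A = {x | x ∈ ball x₀ (ρ + d) ∧ k < u x})
    (hM : 0 ≤ M)
    (hpM : ∀ x ∈ ball x₀ (ρ + d), ∀ y ∈ ball x₀ (ρ + d), (1 + β) * (p x y - 1) ≤ M)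
    (hT1 : 3 * q / (d * β) ≤ T) (hT2 : (4 + 3 * ‖x₀‖) / d ≤ T)
    (hY : ∫⁻ x in A, ENNReal.ofReal ((1 + u x - k) ^ M) ≤ ENNReal.ofReal Y) :
    ∫⁻ x, ∫⁻ y, ENNReal.ofReal (formIntegrand s p u (testFn β k q x₀ ρ d u) x y
      + errTerm s p u A (2 * T ^ ((n : ℝ) + pM)) M k x y
      + errTerm s p u A (2 * T ^ ((n : ℝ) + pM)) M k y x)
      ≤ ENNReal.ofReal (4 * T ^ ((n : ℝ) + pM) * (K + Mt) * Y) := by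
  have hq0 : q ≠ 0 := by
    rintro rfl
    have := hp x₀ x₀
    norm_num at hq
    linarith
  have hAm : MeasurableSet A := by
    rw [hA]; exact measurableSet_ball.inter (measurableSet_lt measurable_const hu.1)
  have hAk : ∀ x ∈ A, k < u x := fun x hx => by rw [hA] at hx; exact hx.2
  have hAΩ : A ⊆ Ω := fun x hx => by rw [hA] at hx; exact hΩ hx.1
  have hT0 : 0 ≤ T := le_trans (by positivity) hT1
  have hφ : MemW s p (testFn β k q x₀ ρ d u) := memW_testFn hn hs hpc hp hu hβ hβ1 hd hq0
  have hle := hsub _ hφ (testFn_nonneg hβ) (Eventually.of_forall fun x hx => by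
    by_contra h
    obtain ⟨h1, h2⟩ := of_testFn_ne_zero hd hq0 h
    exact hx (hΩ (mem_ball.2 (by linarith))))
  refine (lintegral_form_add_error_le hpc (fun x y => (hp x y).1) hu hφ hle
    (measurable_errTerm hAm hpc hu.1) (errTerm_nonneg (by positivity) hAk)
    (formIntegrand_add_errTerm_nonneg hs hp hsymm hβ hβ1 hq hk hd hd1 hρd hA hpM hT1 hT2)).trans ?_
  have := lintegral_errTerm_le (s := s) (p := p) (u := u) (Q := 2 * T ^ ((n : ℝ) + pM)) hAm
    (by positivity) hM hK0 hMt hAk hK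
    (fun x hx => htail x (hAΩ hx))
  calc _ ≤ 2 * (ENNReal.ofReal (2 * T ^ ((n : ℝ) + pM) * (K + Mt)) * ENNReal.ofReal Y) := by
        gcongr; exact this.trans (by gcongr)
    _ = _ := by
        rw [← ENNReal.ofReal_mul (by positivity), ← ENNReal.ofReal_ofNat 2,
          ← ENNReal.ofReal_mul (by norm_num)]
        congr 1; ring

/-- One step of the De Giorgi iteration. -/
lemma exists_level_step {pl pM M Mt R : ℝ}
    (hn : 1 ≤ n) (hs : s ∈ Set.Ioo (0 : ℝ) 1)
    (hpc : Measurable fun z : Rn n × Rn n => p z.1 z.2)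
    (hp : ∀ x y, 1 < p x y ∧ p x y ≤ pM) (hsymm : ∀ x y, p x y = p y x)
    (hu : MemW s p u) (hsub : IsWeakSubsol s p Ω u)
    (hMt : 0 ≤ Mt) (htail : ∀ x ∈ Ω,
      (∫⁻ y, ENNReal.ofReal (|u y| ^ (p x y - 1) / (1 + ‖y‖ ^ ((n : ℝ) + s * p x y))))
        ≤ ENNReal.ofReal Mt)
    (hβ : 0 < β) (hβ1 : β ≤ 1) (hR1 : R ≤ 1) (hΩ : ball x₀ R ⊆ Ω) (hM : 0 ≤ M)
    (hpM : ∀ x ∈ ball x₀ R, ∀ y ∈ ball x₀ R, (1 + β) * (p x y - 1) ≤ M)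
    (hpl : ∀ x ∈ ball x₀ R, ∀ y ∈ ball x₀ R, pl ≤ p x y)
    (hexp : M ≤ pl - 1 - β + M * s / n) :
    ∃ C > 0, ∃ N : ℝ, ∀ k g ρ d Y : ℝ, 0 ≤ k → 0 < g → g ≤ 1 → 0 < d → d ≤ 1 → ρ + d ≤ R →
      0 < Y → 2 ^ (M + 1) * Y ≤ unitVol n * (d / 3) ^ n →
      ∫⁻ x in {x | x ∈ ball x₀ (ρ + d) ∧ k < u x}, ENNReal.ofReal ((1 + u x - k) ^ M)
        ≤ ENNReal.ofReal Y →
      ∫⁻ x in {x | x ∈ ball x₀ ρ ∧ k + g < u x}, ENNReal.ofReal ((1 + u x - k) ^ M)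
        ≤ ENNReal.ofReal (C * (g * d) ^ (-N) * Y ^ (1 + s / n)) := by
  have hs0 := hs.1
  have hpM1 : 1 < pM := by linarith [hp x₀ x₀]
  have hw : 0 < unitVol n := unitVol_pos
  obtain ⟨q, hq⟩ := exists_nat_ge pM
  set K := (∫⁻ z : Rn n, ENNReal.ofReal (kern n s z)).toReal with hKd
  have hK0 : 0 ≤ K := ENNReal.toReal_nonneg
  have hK : ∫⁻ z : Rn n, ENNReal.ofReal (kern n s z) ≤ ENNReal.ofReal K := by
    rw [hKd, ENNReal.ofReal_toReal (lintegral_kern_lt_top hn hs).ne]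
  set T₀ := 3 * q / β + (4 + 3 * ‖x₀‖) with hT₀
  have hT0 : 0 < T₀ := by positivity
  set N := (n : ℝ) + pM with hN
  set c₁ := β * (1 / 4) ^ pM * (unitVol n / 2) * (2 ^ (M + 1) / unitVol n) ^ (-(s / n)) with hc₁
  have hc₁0 : 0 < c₁ := by positivity
  refine ⟨4 * T₀ ^ N * (K + Mt + 1) / c₁, by positivity, N, ?_⟩
  intro k g ρ d Y hk hg hg1 hd hd1 hρR hY0 hYs hY
  set A := {x | x ∈ ball x₀ (ρ + d) ∧ k < u x} with hA
  set A' := {x | x ∈ ball x₀ ρ ∧ k + g < u x} with hA'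
  have hsubset : ball x₀ (ρ + d) ⊆ ball x₀ R := ball_subset_ball hρR
  have hAm' : MeasurableSet A' :=
    measurableSet_ball.inter (measurableSet_lt measurable_const hu.1)
  have hAk : ∀ x ∈ A, k < u x := fun x hx => hx.2
  have hE := lintegral_formIntegrand_testFn_le (T := T₀ / d) hn hs hpc hp hsymm hu hsub hMt htail
    hK0 hK hβ hβ1 hq hk hd hd1 (hρR.trans hR1) (hsubset.trans hΩ) hA hM
    (fun x hx y hy => hpM x (hsubset hx) y (hsubset hy))
    (by
      rw [mul_comm d β, ← div_div, hT₀]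
      exact div_le_div_of_nonneg_right (by linarith [norm_nonneg x₀]) hd.le)
    (by
      rw [hT₀]
      exact div_le_div_of_nonneg_right
        (by linarith [show (0 : ℝ) ≤ 3 * q / β by positivity]) hd.le) hY
  set c := β * (g / 4) ^ pM * (unitVol n / 2) * (2 ^ (M + 1) * Y / unitVol n) ^ (-(s / n)) with hc
  have hc0 : 0 < c := by positivity
  have hcc : c = c₁ * g ^ pM * Y ^ (-(s / n)) := by
    rw [hc, hc₁, show g / 4 = 1 / 4 * g by ring, Real.mul_rpow (by norm_num) hg.le,
      show 2 ^ (M + 1) * Y / unitVol n = 2 ^ (M + 1) / unitVol n * Y by ring,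
      Real.mul_rpow (by positivity) hY0.le]
    ring
  have hlow : ENNReal.ofReal c * ∫⁻ x in A', ENNReal.ofReal ((1 + u x - k) ^ M) ≤
      ENNReal.ofReal (4 * (T₀ / d) ^ N * (K + Mt) * Y) := by
    refine le_trans ?_ hE
    rw [← lintegral_const_mul' _ _ ENNReal.ofReal_ne_top]
    refine le_trans (setLIntegral_mono' hAm' fun x hx => ?_) (setLIntegral_le_lintegral A' _)
    rw [← ENNReal.ofReal_mul hc0.le]
    exact le_lintegral_of_level hn hs hp hu.1 hβ hβ1 hd hd1 hA hM
      (fun x hx y hy => hpl x (hsubset hx) y (hsubset hy)) hexp hg hg1 hY0 hY hYs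
      (errTerm_nonneg (by positivity) hAk) hx.1 hx.2
  have hdiv : ∫⁻ x in A', ENNReal.ofReal ((1 + u x - k) ^ M) ≤
      ENNReal.ofReal (4 * (T₀ / d) ^ N * (K + Mt) * Y / c) := by
    rw [ENNReal.ofReal_div_of_pos hc0, ENNReal.le_div_iff_mul_le
      (Or.inl (ENNReal.ofReal_pos.2 hc0).ne') (Or.inl ENNReal.ofReal_ne_top), mul_comm]
    exact hlow
  refine hdiv.trans (ENNReal.ofReal_le_ofReal ?_)
  have hgN : g ^ N ≤ g ^ pM :=
    Real.rpow_le_rpow_of_exponent_ge hg hg1 (by linarith [(Nat.cast_nonneg n : (0 : ℝ) ≤ n)])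
  have e1 : 4 * T₀ ^ N * (K + Mt + 1) / c₁ * (g * d) ^ (-N) * Y ^ (1 + s / n) =
      4 * (T₀ / d) ^ N * (K + Mt + 1) * Y / (c₁ * g ^ N * Y ^ (-(s / n))) := by
    rw [Real.rpow_neg (by positivity), Real.mul_rpow hg.le hd.le, Real.rpow_add hY0,
      Real.rpow_one, Real.rpow_neg hY0.le, Real.div_rpow hT0.le hd.le]
    field_simp
  rw [e1, hcc]
  have : 0 < Y ^ (-(s / n)) := by positivity
  have h1 : K + Mt ≤ K + Mt + 1 := by linarith
  gcongr

end LevelStep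

section Iteration

variable {n : ℕ} {u : Rn n → ℝ} {x₀ : Rn n}

lemma exists_geometric_ratio {σ C N a b : ℝ} (hσ : 0 < σ) (hC : 0 < C) (ha : 0 < a)
    (hb : 0 < b) (m : ℕ) : ∃ ε > 0, ∃ r > 0, r < 1 ∧ ∀ j : ℕ,
      ε * r ^ j ≤ b * ((1 / 2) ^ j) ^ m ∧
      C * (a * ((1 / 2) ^ j) ^ 2) ^ (-N) * (ε * r ^ j) ^ (1 + σ) ≤ ε * r ^ (j + 1) := by
  set r : ℝ := min (1 / 2 * (1 / 2) ^ m) (((4 : ℝ) ^ (-N)) ^ (1 / σ)) with hr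
  have hr0 : 0 < r := lt_min (by positivity) (by positivity)
  have hr1 : r ≤ (1 / 2 : ℝ) ^ m :=
    (min_le_left _ _).trans (mul_le_of_le_one_left (by positivity) (by norm_num))
  have hrlt : r < 1 := by
    refine (min_le_left _ _).trans_lt ?_
    have : (1 / 2 : ℝ) ^ m ≤ 1 := pow_le_one₀ (by norm_num) (by norm_num)
    linarith
  have hr2 : (4 : ℝ) ^ N * r ^ σ ≤ 1 := by
    have h1 : r ^ σ ≤ (4 : ℝ) ^ (-N) := by
      refine (Real.rpow_le_rpow hr0.le (min_le_right _ _) hσ.le).trans ?_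
      rw [← Real.rpow_mul (by positivity), one_div_mul_cancel hσ.ne', Real.rpow_one]
    calc (4 : ℝ) ^ N * r ^ σ ≤ 4 ^ N * 4 ^ (-N) := by gcongr
      _ = 1 := by rw [← Real.rpow_add (by norm_num)]; simp
  set ε := min b ((r * a ^ N / C) ^ (1 / σ)) with hε
  have hε0 : 0 < ε := lt_min hb (by positivity)
  have hε2 : C * a ^ (-N) * ε ^ σ ≤ r := by
    have h1 : ε ^ σ ≤ r * a ^ N / C := by
      refine (Real.rpow_le_rpow hε0.le (min_le_right _ _) hσ.le).trans ?_
      rw [← Real.rpow_mul (by positivity), one_div_mul_cancel hσ.ne', Real.rpow_one]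
    calc C * a ^ (-N) * ε ^ σ ≤ C * a ^ (-N) * (r * a ^ N / C) := by gcongr
      _ = r := by rw [Real.rpow_neg ha.le]; field_simp
  refine ⟨ε, hε0, r, hr0, hrlt, fun j => ⟨?_, ?_⟩⟩
  · rw [← pow_mul, mul_comm j m, pow_mul]
    gcongr
    exact min_le_left _ _
  · have e1 : ((a * ((1 / 2) ^ j) ^ 2) ^ (-N) : ℝ) = a ^ (-N) * (4 ^ N) ^ j := by
      rw [Real.mul_rpow ha.le (by positivity)]
      have e4 : (((1 / 2) ^ j) ^ 2 : ℝ) = (4 ^ j)⁻¹ := by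
        rw [← pow_mul, mul_comm, pow_mul, ← inv_pow]; norm_num
      rw [e4, Real.inv_rpow (by positivity), ← Real.rpow_neg (by positivity), neg_neg,
        ← Real.rpow_natCast, ← Real.rpow_natCast, ← Real.rpow_mul (by norm_num),
        ← Real.rpow_mul (by norm_num), mul_comm N]
    have e2 : (ε * r ^ j) ^ (1 + σ) = ε * r ^ j * (ε ^ σ * (r ^ σ) ^ j) := by
      rw [Real.rpow_add (by positivity), Real.rpow_one, Real.mul_rpow hε0.le (by positivity)]
      congr 2
      rw [← Real.rpow_natCast, ← Real.rpow_mul hr0.le, ← Real.rpow_natCast,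
        ← Real.rpow_mul hr0.le, mul_comm]
    calc C * (a * ((1 / 2) ^ j) ^ 2) ^ (-N) * (ε * r ^ j) ^ (1 + σ)
        = ε * r ^ j * ((C * a ^ (-N) * ε ^ σ) * (4 ^ N * r ^ σ) ^ j) := by
          rw [e1, e2, mul_pow]; ring
      _ ≤ ε * r ^ j * (r * 1) := by
          gcongr
          exact pow_le_one₀ (by positivity) hr2
      _ = ε * r ^ (j + 1) := by ring

/-- De Giorgi iteration: a level-gap estimate turns smallness on one level into boundedness. -/
lemma exists_small_imp_ae_le {σ C N M R ω : ℝ} (hu : Measurable u) (hσ : 0 < σ) (hC : 0 < C)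
    (hM : 0 ≤ M) (hR : 0 < R) (hR1 : R ≤ 1) (hω : 0 < ω)
    (hstep : ∀ k g ρ d Y : ℝ, 0 ≤ k → 0 < g → g ≤ 1 → 0 < d → d ≤ 1 → ρ + d ≤ R →
      0 < Y → 2 ^ (M + 1) * Y ≤ ω * (d / 3) ^ n →
      ∫⁻ x in {x | x ∈ ball x₀ (ρ + d) ∧ k < u x}, ENNReal.ofReal ((1 + u x - k) ^ M)
        ≤ ENNReal.ofReal Y →
      ∫⁻ x in {x | x ∈ ball x₀ ρ ∧ k + g < u x}, ENNReal.ofReal ((1 + u x - k) ^ M)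
        ≤ ENNReal.ofReal (C * (g * d) ^ (-N) * Y ^ (1 + σ))) :
    ∃ ε > 0, ∀ k₀ : ℝ, 0 ≤ k₀ →
      ∫⁻ x in {x | x ∈ ball x₀ R ∧ k₀ < u x}, ENNReal.ofReal ((1 + u x - k₀) ^ M)
        ≤ ENNReal.ofReal ε →
      ∀ᵐ x, x ∈ ball x₀ (R / 2) → u x ≤ k₀ + 1 := by
  obtain ⟨ε, hε, r, hr, hr1, hj⟩ := exists_geometric_ratio (a := R / 8)
    (b := ω * (R / 12) ^ n / 2 ^ (M + 1)) hσ hC (by positivity) (by positivity) n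
  refine ⟨ε, hε, fun k₀ hk₀ hinit => ?_⟩
  have key : ∀ j : ℕ, ∫⁻ x in {x | x ∈ ball x₀ (R / 2 * (1 + (1 / 2) ^ j)) ∧
      k₀ + 1 - (1 / 2) ^ j < u x}, ENNReal.ofReal ((1 + u x - (k₀ + 1 - (1 / 2) ^ j)) ^ M)
        ≤ ENNReal.ofReal (ε * r ^ j) := by
    intro j
    induction j with
    | zero =>
      rw [pow_zero, pow_zero, mul_one, show R / 2 * (1 + 1) = R by ring, add_sub_cancel_right]
      exact hinit
    | succ j ih =>
      have ht0 : (0 : ℝ) < (1 / 2) ^ j := by positivity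
      have ht1 : (1 / 2 : ℝ) ^ j ≤ 1 := pow_le_one₀ (by norm_num) (by norm_num)
      obtain ⟨hj1, hj2⟩ := hj j
      have hts : (1 / 2 : ℝ) ^ (j + 1) = (1 / 2) ^ j / 2 := by rw [pow_succ]; ring
      rw [hts]
      set t : ℝ := (1 / 2) ^ j with ht
      have h := hstep (k₀ + 1 - t) (t / 2) (R / 2 * (1 + t / 2)) (R / 2 * (t / 2)) (ε * r ^ j)
        (by linarith) (by positivity) (by linarith) (by positivity) (by nlinarith) (by nlinarith)
        (by positivity) ?_ ?_
      · rw [show k₀ + 1 - t + t / 2 = k₀ + 1 - t / 2 by ring,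
          show t / 2 * (R / 2 * (t / 2)) = R / 8 * t ^ 2 by ring] at h
        refine le_trans (setLIntegral_mono' ?_ fun x hx => ?_)
          (h.trans (ENNReal.ofReal_le_ofReal hj2))
        · exact measurableSet_ball.inter (measurableSet_lt measurable_const hu)
        · have hx2 : k₀ + 1 - t / 2 < u x := hx.2
          exact ENNReal.ofReal_le_ofReal
            (Real.rpow_le_rpow (by linarith) (by linarith) hM)
      · calc 2 ^ (M + 1) * (ε * r ^ j)
            ≤ 2 ^ (M + 1) * (ω * (R / 12) ^ n / 2 ^ (M + 1) * t ^ n) := by gcongr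
          _ = ω * ((R / 12) * t) ^ n := by rw [mul_pow]; field_simp
          _ = _ := by congr 2; ring
      · rw [show R / 2 * (1 + t / 2) + R / 2 * (t / 2) = R / 2 * (1 + t) by ring]
        exact ih
  have hS : volume {x | x ∈ ball x₀ (R / 2) ∧ k₀ + 1 < u x} = 0 := by
    set S := {x | x ∈ ball x₀ (R / 2) ∧ k₀ + 1 < u x} with hSd
    have hSm : MeasurableSet S :=
      measurableSet_ball.inter (measurableSet_lt measurable_const hu)
    have hle : ∀ j : ℕ, volume S ≤ ENNReal.ofReal (ε * r ^ j) := by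
      intro j
      refine le_trans ?_ (key j)
      have ht0 : (0 : ℝ) < (1 / 2) ^ j := by positivity
      have hsub : S ⊆ {x | x ∈ ball x₀ (R / 2 * (1 + (1 / 2) ^ j)) ∧
          k₀ + 1 - (1 / 2) ^ j < u x} := fun x hx =>
        ⟨ball_subset_ball (by nlinarith) hx.1, by linarith [hx.2]⟩
      rw [← setLIntegral_one]
      refine le_trans (setLIntegral_mono' hSm fun x hx => ?_) (lintegral_mono_set hsub)
      rw [← ENNReal.ofReal_one]
      exact ENNReal.ofReal_le_ofReal (Real.one_le_rpow (by linarith [hx.2]) hM)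
    have hlim : Tendsto (fun j : ℕ => ENNReal.ofReal (ε * r ^ j)) atTop (𝓝 0) := by
      have := (tendsto_pow_atTop_nhds_zero_of_lt_one hr.le hr1).const_mul ε
      rw [mul_zero] at this
      simpa using ENNReal.tendsto_ofReal this
    exact le_antisymm (ge_of_tendsto' hlim hle) zero_le
  rw [ae_iff]
  convert hS using 3
  simp

/-- The integrals over high superlevel sets are small. -/
lemma exists_level_lintegral_le {M ε : ℝ} {B : Set (Rn n)} (hB : MeasurableSet B)
    (hu : Measurable u) (hM : 0 ≤ M) (hε : 0 < ε)
    (h_lint_fin : ∫⁻ x in B, ENNReal.ofReal ((1 + |u x|) ^ M) ≠ ⊤) :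
    ∃ k : ℝ, 0 ≤ k ∧ ∫⁻ x in {x | x ∈ B ∧ k < u x}, ENNReal.ofReal ((1 + u x - k) ^ M)
      ≤ ENNReal.ofReal ε := by
  have hlim : Tendsto (fun j : ℕ => ∫⁻ x in B, {x | (j : ℝ) < u x}.indicator
      (fun x => ENNReal.ofReal ((1 + |u x|) ^ M)) x) atTop (𝓝 (∫⁻ x in B, 0)) := by
    refine tendsto_lintegral_of_dominated_convergence
      (fun x => ENNReal.ofReal ((1 + |u x|) ^ M)) (fun j => ?_) (fun j => ?_) h_lint_fin ?_
    · refine Measurable.indicator ?_ (measurableSet_lt measurable_const hu)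
      fun_prop
    · exact Eventually.of_forall fun x => indicator_le_self _ _ x
    · refine Eventually.of_forall fun x => ?_
      refine tendsto_const_nhds.congr' ?_
      obtain ⟨m, hm⟩ := exists_nat_ge (u x)
      filter_upwards [eventually_ge_atTop m] with j hj
      have hmj : (m : ℝ) ≤ j := Nat.cast_le.2 hj
      rw [indicator_of_notMem]
      change ¬ (j : ℝ) < u x
      linarith
  rw [lintegral_zero] at hlim
  obtain ⟨j, hj⟩ := (hlim.eventually_le_const (ENNReal.ofReal_pos.2 hε)).exists
  refine ⟨j, Nat.cast_nonneg j, le_trans ?_ hj⟩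
  have hLm : MeasurableSet {x | (j : ℝ) < u x} := measurableSet_lt measurable_const hu
  have hset : {x | x ∈ B ∧ (j : ℝ) < u x} = {x | (j : ℝ) < u x} ∩ B := by
    ext x; exact and_comm
  rw [setLIntegral_indicator hLm, hset]
  refine setLIntegral_mono' (hLm.inter hB) fun x hx => ?_
  have hj0 : (0 : ℝ) ≤ j := Nat.cast_nonneg j
  have hxj : (j : ℝ) < u x := hx.1
  exact ENNReal.ofReal_le_ofReal
    (Real.rpow_le_rpow (by linarith) (by linarith [le_abs_self (u x)]) hM)

end Iteration

section Main

variable {n : ℕ} {s : ℝ} {p : Rn n → Rn n → ℝ} {u : Rn n → ℝ} {x₀ : Rn n} {Ω : Set (Rn n)}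

lemma setLIntegral_one_add_abs_rpow_lt_top {M pM : ℝ} {B : Set (Rn n)} (hB : MeasurableSet B)
    (hBf : volume B < ⊤) (hp : ∀ x y, 1 < p x y ∧ p x y ≤ pM) (hu : MemW s p u)
    (hM : ∀ x ∈ B, M ≤ p x x) :
    ∫⁻ x in B, ENNReal.ofReal ((1 + |u x|) ^ M) < ⊤ := by
  have hpt : ∀ x ∈ B, ENNReal.ofReal ((1 + |u x|) ^ M) ≤
      ENNReal.ofReal (2 ^ pM) * (1 + ENNReal.ofReal (|u x| ^ p x x)) := by
    intro x hx
    obtain ⟨hp1, hp2⟩ := hp x x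
    have ha := abs_nonneg (u x)
    have h0 : 0 ≤ |u x| ^ p x x := by positivity
    rw [← ENNReal.ofReal_one, ← ENNReal.ofReal_add zero_le_one h0,
      ← ENNReal.ofReal_mul (by positivity)]
    apply ENNReal.ofReal_le_ofReal
    have hmax : 1 + |u x| ≤ 2 * max 1 |u x| := by
      linarith [le_max_left 1 |u x|, le_max_right 1 |u x|]
    calc (1 + |u x|) ^ M ≤ (1 + |u x|) ^ p x x :=
          Real.rpow_le_rpow_of_exponent_le (by linarith) (hM x hx)
      _ ≤ (2 * max 1 |u x|) ^ p x x := Real.rpow_le_rpow (by linarith) hmax (by linarith)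
      _ = 2 ^ p x x * max 1 |u x| ^ p x x := Real.mul_rpow (by norm_num) (by positivity)
      _ ≤ 2 ^ pM * (1 + |u x| ^ p x x) := by
        refine mul_le_mul (Real.rpow_le_rpow_of_exponent_le (by norm_num) hp2) ?_
          (by positivity) (by positivity)
        rcases max_cases 1 |u x| with h | h <;> rw [h.1]
        · rw [Real.one_rpow]; linarith
        · linarith
  refine lt_of_le_of_lt (setLIntegral_mono' hB hpt) ?_
  rw [lintegral_const_mul' _ _ ENNReal.ofReal_ne_top, lintegral_add_left measurable_const,
    setLIntegral_one]
  refine ENNReal.mul_lt_top ENNReal.ofReal_lt_top (ENNReal.add_lt_top.2 ⟨hBf, ?_⟩)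
  exact (setLIntegral_le_lintegral _ _).trans_lt hu.2.1

/-- Weak subsolutions with controlled tail are locally bounded above. -/
lemma IsWeakSubsol.exists_ae_le (hn : 1 ≤ n) (hs : s ∈ Set.Ioo (0 : ℝ) 1) (hp : ExponentOK p)
    (hΩ : IsOpen Ω) (hu : MemW s p u) (hsub : IsWeakSubsol s p Ω u)
    (htail : ∃ M : ℝ, ∀ x ∈ Ω,
      (∫⁻ y, ENNReal.ofReal (|u y| ^ (p x y - 1) / (1 + ‖y‖ ^ ((n : ℝ) + s * p x y))))
        ≤ ENNReal.ofReal M) (hx₀ : x₀ ∈ Ω) :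
    ∃ r > 0, ball x₀ r ⊆ Ω ∧ ∃ M : ℝ, ∀ᵐ x, x ∈ ball x₀ r → u x ≤ M := by
  obtain ⟨hpc, hsymm, pm, pM, hpm, hpb⟩ := hp
  obtain ⟨Mt, hMt⟩ := htail
  have hp' : ∀ x y, 1 < p x y ∧ p x y ≤ pM := fun x y => ⟨hpm.trans_le (hpb x y).1, (hpb x y).2⟩
  have hn0 : (0 : ℝ) < n := by positivity
  obtain ⟨σ, hσd⟩ : ∃ σ : ℝ, σ = s / n := ⟨_, rfl⟩
  have hσ : 0 < σ := hσd ▸ div_pos hs.1 hn0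
  set P := p x₀ x₀ with hP
  obtain ⟨hPm, hPM⟩ := hpb x₀ x₀
  have hτ : 0 < (pm - 1) * σ := mul_pos (by linarith) hσ
  obtain ⟨κ, hκ, hκ1, hκτ⟩ : ∃ κ : ℝ, 0 < κ ∧ κ ≤ 1 / 4 ∧ 4 * κ ≤ (pm - 1) * σ :=
    ⟨min 1 ((pm - 1) * σ) / 4, by positivity,
      by linarith [min_le_left 1 ((pm - 1) * σ)],
      by linarith [min_le_right 1 ((pm - 1) * σ)]⟩
  set β := κ / (pM + 1) with hβd
  have hpM0 : 0 < pM + 1 := by linarith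
  have hβ : 0 < β := by positivity
  have hβP : β * (pM + 1) = κ := by rw [hβd]; field_simp
  have hβκ : β ≤ κ := by rw [← hβP]; nlinarith
  have hβ1 : β ≤ 1 := by linarith
  obtain ⟨η, hη, hclose⟩ := Metric.continuous_iff.1 hpc (x₀, x₀) (κ / 2) (by positivity)
  obtain ⟨r₀, hr₀, hr₀Ω⟩ := Metric.isOpen_iff.1 hΩ x₀ hx₀
  set R := min 1 (min η r₀) with hR
  have hR0 : 0 < R := lt_min one_pos (lt_min hη hr₀)
  have hR1 : R ≤ 1 := min_le_left _ _
  have hRη : R ≤ η := (min_le_right _ _).trans (min_le_left _ _)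
  have hRr : R ≤ r₀ := (min_le_right _ _).trans (min_le_right _ _)
  have hRΩ : ball x₀ R ⊆ Ω := (ball_subset_ball hRr).trans hr₀Ω
  have hnear : ∀ x ∈ ball x₀ R, ∀ y ∈ ball x₀ R, P - κ / 2 ≤ p x y ∧ p x y ≤ P + κ / 2 := by
    intro x hx y hy
    have h := hclose (x, y) (by
      rw [Prod.dist_eq]
      exact max_lt (hx.trans_le hRη) (hy.trans_le hRη))
    rw [Real.dist_eq, abs_lt] at h
    constructor <;> linarith [h.1, h.2]
  set M := (1 + β) * (P + κ / 2 - 1) with hM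
  have hMlow : pm - 1 ≤ M := by rw [hM]; nlinarith
  have hM0 : 0 ≤ M := by linarith
  have hMup : M ≤ P - κ / 2 - 1 - β + 4 * κ := by
    have : β * P ≤ κ := by rw [← hβP]; nlinarith
    have : β * κ ≤ κ := by nlinarith
    rw [hM]; nlinarith
  have hMσ : (pm - 1) * σ ≤ M * σ := mul_le_mul_of_nonneg_right hMlow hσ.le
  obtain ⟨C, hC, N, hstep⟩ := exists_level_step (x₀ := x₀) (pl := P - κ / 2) (M := M)
    (Mt := max Mt 0) (R := R) hn hs hpc.measurable hp' hsymm hu hsub (le_max_right _ _)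
    (fun x hx => (hMt x hx).trans (ENNReal.ofReal_le_ofReal (le_max_left _ _))) hβ hβ1 hR1 hRΩ hM0
    (fun x hx y hy => by
      have := (hnear x hx y hy).2
      exact mul_le_mul_of_nonneg_left (by linarith) (by linarith))
    (fun x hx y hy => (hnear x hx y hy).1) (by rw [mul_div_assoc, ← hσd]; linarith)
  rw [← hσd] at hstep
  obtain ⟨ε, hε, hbound⟩ := exists_small_imp_ae_le hu.1 hσ hC hM0 hR0 hR1 unitVol_pos hstep
  obtain ⟨k, hk, hkε⟩ := exists_level_lintegral_le measurableSet_ball hu.1 hM0 hε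
    (setLIntegral_one_add_abs_rpow_lt_top (M := M) measurableSet_ball
      (measure_ball_lt_top (x := x₀) (r := R)) hp' hu
      (fun x hx => by have := (hnear x hx x hx).1; linarith)).ne
  exact ⟨R / 2, by positivity, (ball_subset_ball (by linarith)).trans hRΩ, k + 1,
    hbound k hk hkε⟩

lemma MemW.neg (hu : MemW s p u) : MemW s p (-u) := by
  refine ⟨hu.1.neg, ?_, ?_⟩
  · simpa using hu.2.1
  · refine lt_of_eq_of_lt ?_ hu.2.2
    refine lintegral_congr fun x => lintegral_congr fun y => ?_
    rw [Pi.neg_apply, Pi.neg_apply, show -u x - -u y = -(u x - u y) by ring, abs_neg]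

lemma IsWeakSupersol.neg (hu : IsWeakSupersol s p Ω u) : IsWeakSubsol s p Ω (-u) := by
  intro φ hφ hφ0 hφΩ
  have h := hu φ hφ hφ0 hφΩ
  rw [← neg_nonneg, ← integral_neg]
  refine h.trans_eq (integral_congr_ae (Eventually.of_forall fun x => ?_))
  change _ = -_
  rw [← integral_neg]
  refine integral_congr_ae (Eventually.of_forall fun y => ?_)
  change _ = -_
  rw [Pi.neg_apply, Pi.neg_apply, show -u x - -u y = -(u x - u y) by ring, abs_neg]
  ring

end Main

/-- weak solutions are locally essentially bounded. -/
theorem statement2 {n : ℕ} (hn : 1 ≤ n) (s : ℝ) (hs : s ∈ Set.Ioo (0:ℝ) 1)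
    (p : Rn n → Rn n → ℝ) (hp : ExponentOK p)
    (Ω : Set (Rn n)) (hΩo : IsOpen Ω) (hΩb : Bornology.IsBounded Ω) (hΩne : Ω.Nonempty)
    (u : Rn n → ℝ) (hu : MemW s p u) (hsol : IsWeakSol s p Ω u)
    (htail : ∃ M : ℝ, ∀ x ∈ Ω,
      (∫⁻ y, ENNReal.ofReal (|u y| ^ (p x y - 1) / (1 + ‖y‖ ^ ((n : ℝ) + s * p x y))))
        ≤ ENNReal.ofReal M) :
    ∀ x₀ ∈ Ω, ∃ r > 0, ball x₀ r ⊆ Ω ∧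
      ∃ M : ℝ, ∀ᵐ x, x ∈ ball x₀ r → |u x| ≤ M := by
  intro x₀ hx₀
  obtain ⟨r₁, hr₁, hr₁Ω, M₁, hM₁⟩ := hsol.1.exists_ae_le hn hs hp hΩo hu htail hx₀
  obtain ⟨r₂, hr₂, -, M₂, hM₂⟩ := hsol.2.neg.exists_ae_le hn hs hp hΩo hu.neg
    (by simpa only [Pi.neg_apply, abs_neg] using htail) hx₀
  refine ⟨min r₁ r₂, lt_min hr₁ hr₂, (ball_subset_ball (min_le_left _ _)).trans hr₁Ω,
    max M₁ M₂, ?_⟩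
  filter_upwards [hM₁, hM₂] with x h1 h2 hx
  have h1 := h1 (ball_subset_ball (min_le_left _ _) hx)
  have h2 := h2 (ball_subset_ball (min_le_right _ _) hx)
  rw [Pi.neg_apply] at h2
  exact abs_le.2 ⟨by linarith [le_max_right M₁ M₂], h1.trans (le_max_left _ _)⟩
end
end

section
/- Let 1 < p₋ ≤ p₊ < ∞ and let P ∈ ℝ with p₋ ≤ P ≤ p₊. Then for all a, b ≥ 0 and all τ₁, τ₂ ∈ [0,1]: |a−b|^{P−2}(a−b)(a·τ₁^{p₊} − b·τ₂^{p₊}) ≥ (1/2)|a−b|^{P} (max{τ₁,τ₂})^{p₊} − C (max{a,b})^{P} |τ₁−τ₂|^{P}, where C = (p₊/p₋)(2p₊)^{p₊−1} (and the expression |a−b|^{P−2}(a−b) is interpreted as 0 when a = b). -/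
open MeasureTheory Metric Set Filter
open scoped ENNReal Topology
noncomputable section

/-- Young's inequality with the weight `1 / 2` on the power of conjugate exponent. -/
theorem rpow_sub_one_mul_le_half_add {P z w : ℝ} (hP : 1 < P) (hz : 0 ≤ z) (hw : 0 ≤ w) :
    z ^ (P - 1) * w ≤ 1 / 2 * z ^ P + 2 ^ (P - 1) * w ^ P / P := by
  have hP0 : 0 < P := by linarith
  have hP1 : 0 < P - 1 := by linarith
  have hpq : P.HolderConjugate (P / (P - 1)) := Real.HolderConjugate.conjExponent hP
  have hr : (0 : ℝ) < 2 ^ ((P - 1) / P) := by positivity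
  have young := Real.young_inequality_of_nonneg (a := 2 ^ ((P - 1) / P) * w)
    (b := z ^ (P - 1) / 2 ^ ((P - 1) / P)) (by positivity) (by positivity) hpq
  rw [Real.mul_rpow hr.le hw, Real.div_rpow (by positivity) hr.le, ← Real.rpow_mul (by norm_num),
    ← Real.rpow_mul hz, ← Real.rpow_mul (by norm_num), div_mul_cancel₀ _ hP0.ne',
    mul_div_cancel₀ _ hP1.ne', div_mul_div_cancel₀ hP0.ne', div_self hP1.ne',
    Real.rpow_one] at young
  have hzP : z ^ P / 2 / (P / (P - 1)) ≤ 1 / 2 * z ^ P := by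
    rw [div_le_iff₀ (by positivity), ← mul_div_assoc, le_div_iff₀ hP1]
    nlinarith [Real.rpow_nonneg hz P]
  calc z ^ (P - 1) * w
      = 2 ^ ((P - 1) / P) * w * (z ^ (P - 1) / 2 ^ ((P - 1) / P)) := by field_simp
    _ ≤ _ := by linarith

/-- The tangent line estimate for `x ↦ x ^ q` at the larger of two points. -/
theorem rpow_sub_rpow_le_mul_sub {q s t : ℝ} (hq : 1 ≤ q) (hs : 0 ≤ s) (ht : 0 < t) :
    t ^ q - s ^ q ≤ q * t ^ (q - 1) * (t - s) := by
  have bernoulli := one_add_mul_self_le_rpow_one_add (s := s / t - 1)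
    (by linarith [div_nonneg hs ht.le]) hq
  rw [add_sub_cancel, Real.div_rpow hs ht.le, le_div_iff₀ (by positivity)] at bernoulli
  have htq : t ^ q = t ^ (q - 1) * t := by
    rw [Real.rpow_sub_one ht.ne', div_mul_cancel₀ _ ht.ne']
  have : (1 + q * (s / t - 1)) * t ^ q = t ^ q - q * t ^ (q - 1) * (t - s) := by
    rw [htq]
    field_simp
    ring
  linarith

theorem rpow_sub_one_mul_sub_ge_of_lt {pm pM P : ℝ} (h1 : 1 < pm) (hP : pm ≤ P) (hP' : P ≤ pM)
    {a b τ₁ τ₂ : ℝ} (hb : 0 ≤ b) (hab : b < a) (hτ₁ : 0 ≤ τ₁) (hτ₂ : τ₂ ∈ Set.Icc (0:ℝ) 1) :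
    1 / 2 * (a - b) ^ P * (max τ₁ τ₂) ^ pM
        - (pM / pm) * (2 * pM) ^ (pM - 1) * a ^ P * |τ₁ - τ₂| ^ P
      ≤ (a - b) ^ (P - 1) * (a * τ₁ ^ pM - b * τ₂ ^ pM) := by
  have hP0 : 0 < P := by linarith
  have hpm : 0 < pm := by linarith
  have hpM : 0 < pM := by linarith
  have ha : 0 < a := by linarith
  have hd : 0 < a - b := by linarith
  have hdP : (a - b) ^ P = (a - b) ^ (P - 1) * (a - b) := by
    rw [Real.rpow_sub_one hd.ne', div_mul_cancel₀ _ hd.ne']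
  have hC : 0 ≤ (pM / pm) * (2 * pM) ^ (pM - 1) * a ^ P * |τ₁ - τ₂| ^ P := by positivity
  rcases le_or_gt τ₂ τ₁ with h | h
  · rw [max_eq_left h]
    have hpow : τ₂ ^ pM ≤ τ₁ ^ pM := Real.rpow_le_rpow hτ₂.1 h hpM.le
    have hmain : (a - b) ^ P * τ₁ ^ pM ≤ (a - b) ^ (P - 1) * (a * τ₁ ^ pM - b * τ₂ ^ pM) := by
      rw [hdP, mul_assoc]
      gcongr
      nlinarith
    have : 0 ≤ (a - b) ^ P * τ₁ ^ pM := by positivity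
    linarith
  · have ht : 0 < τ₂ := hτ₁.trans_lt h
    have hδ : 0 < τ₂ - τ₁ := by linarith
    rw [max_eq_right h.le, abs_sub_comm, abs_of_pos hδ]
    have htangent := rpow_sub_rpow_le_mul_sub (q := pM) (by linarith) hτ₁ ht
    have hexp : τ₂ ^ (pM - 1) ≤ (τ₂ ^ (pM / P)) ^ (P - 1) := by
      rw [← Real.rpow_mul ht.le]
      refine Real.rpow_le_rpow_of_exponent_ge ht hτ₂.2 ?_
      rw [div_mul_eq_mul_div, div_le_iff₀ hP0]
      linarith
    have young := rpow_sub_one_mul_le_half_add (P := P) (z := (a - b) * τ₂ ^ (pM / P))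
      (w := pM * (a * (τ₂ - τ₁))) (by linarith) (by positivity) (by positivity)
    rw [Real.mul_rpow hd.le (by positivity), Real.mul_rpow hd.le (by positivity),
      ← Real.rpow_mul ht.le _ P, div_mul_cancel₀ _ hP0.ne', Real.mul_rpow hpM.le (by positivity),
      Real.mul_rpow ha.le hδ.le] at young
    have hconst : 2 ^ (P - 1) * pM ^ P / P ≤ pM / pm * (2 * pM) ^ (pM - 1) := by
      have : 2 ^ (P - 1) * pM ^ P / P = pM / P * (2 * pM) ^ (P - 1) := by
        rw [Real.mul_rpow (by norm_num) hpM.le, Real.rpow_sub_one hpM.ne' P]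
        field_simp
      rw [this]
      gcongr
      linarith
    have hlow : (a - b) ^ (P - 1) * (a * (τ₂ ^ pM - τ₁ ^ pM))
        ≤ (a - b) ^ (P - 1) * (τ₂ ^ (pM / P)) ^ (P - 1) * (pM * (a * (τ₂ - τ₁))) := by
      calc (a - b) ^ (P - 1) * (a * (τ₂ ^ pM - τ₁ ^ pM))
          ≤ (a - b) ^ (P - 1) * (a * (pM * (τ₂ ^ (pM / P)) ^ (P - 1) * (τ₂ - τ₁))) := by
            gcongr
            exact htangent.trans (by gcongr)
        _ = _ := by ring
    have hhigh := mul_le_mul_of_nonneg_right hconst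
      (by positivity : 0 ≤ a ^ P * (τ₂ - τ₁) ^ P)
    have hsplit : (a - b) ^ (P - 1) * (a * τ₁ ^ pM - b * τ₂ ^ pM)
        = (a - b) ^ P * τ₂ ^ pM - (a - b) ^ (P - 1) * (a * (τ₂ ^ pM - τ₁ ^ pM)) := by
      rw [hdP]
      ring
    rw [hsplit]
    have hassoc : 2 ^ (P - 1) * (pM ^ P * (a ^ P * (τ₂ - τ₁) ^ P)) / P
        = 2 ^ (P - 1) * pM ^ P / P * (a ^ P * (τ₂ - τ₁) ^ P) := by ring
    rw [hassoc] at young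
    linarith

/-- the discrete algebraic inequality (Lemma 3.3). -/
theorem statement5 (pm pM P : ℝ) (h1 : 1 < pm) (h2 : pm ≤ pM)
    (hP : pm ≤ P) (hP' : P ≤ pM)
    (a b τ₁ τ₂ : ℝ) (ha : 0 ≤ a) (hb : 0 ≤ b)
    (hτ₁ : τ₁ ∈ Set.Icc (0:ℝ) 1) (hτ₂ : τ₂ ∈ Set.Icc (0:ℝ) 1) :
    (1 / 2) * |a - b| ^ P * (max τ₁ τ₂) ^ pM
        - (pM / pm) * (2 * pM) ^ (pM - 1) * (max a b) ^ P * |τ₁ - τ₂| ^ P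
      ≤ |a - b| ^ (P - 2) * (a - b) * (a * τ₁ ^ pM - b * τ₂ ^ pM) := by
  have hpow {d : ℝ} (hd : 0 < d) : d ^ (P - 2) * d = d ^ (P - 1) := by
    rw [← Real.rpow_add_one hd.ne']
    ring_nf
  rcases lt_trichotomy a b with hab | rfl | hab
  · have key := rpow_sub_one_mul_sub_ge_of_lt h1 hP hP' ha hab hτ₂.1 hτ₁
    rw [← hpow (sub_pos.2 hab), max_comm τ₂, abs_sub_comm τ₂] at key
    rw [abs_sub_comm a b, abs_of_pos (sub_pos.2 hab), max_eq_right hab.le]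
    linarith
  · have hpm : 0 < pm := by linarith
    have hpM : 0 < pM := by linarith
    have : 0 ≤ (pM / pm) * (2 * pM) ^ (pM - 1) * a ^ P * |τ₁ - τ₂| ^ P := by positivity
    simpa [Real.zero_rpow (by linarith : P ≠ 0)] using this
  · have key := rpow_sub_one_mul_sub_ge_of_lt h1 hP hP' hb hab hτ₁.1 hτ₂
    rwa [abs_of_pos (sub_pos.2 hab), max_eq_left hab.le, hpow (sub_pos.2 hab)]
end
end
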